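/- Let α ∈ (0,1), C > 1 and N ≥ 1 an integer. Let b ∈ C^∞(𝕋³) and let ξ : ℝ³ → ℝ³ be smooth with ξ(x + 2πl) = ξ(x) + 2πl for all l ∈ ℤ³, satisfying C^{−1}|v| ≤ |∇ξ(x)^T v| and |∇ξ(x)| ≤ C for all x and v ∈ ℝ³. Then for every k ∈ ℤ³∖{0} there exists a smooth symmetric trace-free matrix field R on 𝕋³ (namely R = 𝓡(b e^{ik·ξ}) for the standard inverse divergence operator 𝓡) such that ∇·R = b e^{ik·ξ} − ⨍_{𝕋³} b e^{ik·ξ} dx and ‖R‖_{C^α(𝕋³)} ≤ C' ( ‖b‖₀ / |k|^{1−α} + (‖b‖_{N+α} + ‖b‖₀ ‖∇ξ‖_{N+α}) / |k|^{N−α} ), with C' depending only on C, α, N. -/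

import Mathlib

open MeasureTheory Real

noncomputable section

abbrev Pt := Fin 3 → ℝ
abbrev Vec := Fin 3 → ℝ

/-- 2π-periodicity in each coordinate. -/
def per3 {E : Type*} (f : Pt → E) : Prop :=
  ∀ (l : Fin 3 → ℤ) (x : Pt), f (x + fun i => 2 * π * (l i : ℝ)) = f x

/-- Fundamental domain of the torus 𝕋³. -/
def Box3 : Set Pt := Set.univ.pi fun _ => Set.Ioc (-π) π

/-- Partial derivative in the i-th coordinate direction. -/
def pd {E : Type*} [NormedAddCommGroup E] [NormedSpace ℝ E]
    (i : Fin 3) (f : Pt → E) (x : Pt) : E :=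
  fderiv ℝ f x (Pi.single i 1)

/-- Euclidean norm on ℝ³. -/
def enorm3 (w : Pt) : ℝ := Real.sqrt (∑ i, (w i) ^ 2)

/-- The phase map condition: ξ(x + 2πl) = ξ(x) + 2πl, making ∇ξ periodic and
x ↦ e^{ik·ξ(x)} periodic for k ∈ ℤ³. -/
def PhaseMap (ξ : Pt → Pt) : Prop :=
  ∀ (l : Fin 3 → ℤ) (x : Pt),
    ξ (x + fun i => 2 * π * (l i : ℝ)) = ξ x + fun i => 2 * π * (l i : ℝ)

/-- Nondegeneracy: C⁻¹|v| ≤ |∇ξ(x)ᵀ v| and |∇ξ(x)| ≤ C. -/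
def NonDeg (C : ℝ) (ξ : Pt → Pt) : Prop :=
  (∀ (x : Pt) (v : Vec), C⁻¹ * enorm3 v ≤ enorm3 fun i => ∑ mm, pd i ξ x mm * v mm) ∧
  (∀ x : Pt, ‖fderiv ℝ ξ x‖ ≤ C)

/-- The oscillatory factor e^{i k·ξ(x)}. -/
def osc (ξ : Pt → Pt) (k : Fin 3 → ℤ) (x : Pt) : ℂ :=
  Complex.exp (Complex.I * ((∑ mm, (k mm : ℝ) * ξ x mm : ℝ) : ℂ))

open scoped ContDiff

/-- A smooth `2π`-periodic function. -/
structure PerSmooth {E : Type*} [NormedAddCommGroup E] [NormedSpace ℝ E] (f : Pt → E) : Prop where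
  smooth : ContDiff ℝ ∞ f
  per : per3 f

section Basic

variable {E : Type*} [NormedAddCommGroup E] [NormedSpace ℝ E]

theorem contDiff_pd {f : Pt → E} (hf : ContDiff ℝ ∞ f) (i : Fin 3) : ContDiff ℝ ∞ (pd i f) :=
  (hf.fderiv_right (m := ∞) le_rfl).clm_apply contDiff_const

theorem per3_fderiv {f : Pt → E} (hf : per3 f) : per3 (fderiv ℝ f) := by
  intro l x
  rw [← fderiv_comp_add_right]
  congr 1
  funext y
  exact hf l y

theorem PerSmooth.fderiv {f : Pt → E} (hf : PerSmooth f) : PerSmooth (fderiv ℝ f) :=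
  ⟨hf.smooth.fderiv_right (m := ∞) le_rfl, per3_fderiv hf.per⟩

theorem PerSmooth.pd {f : Pt → E} (hf : PerSmooth f) (i : Fin 3) : PerSmooth (pd i f) := by
  refine ⟨contDiff_pd hf.smooth i, fun l x => ?_⟩
  have := hf.fderiv.per l x
  simp only [_root_.pd, this]

theorem PerSmooth.differentiable {f : Pt → E} (hf : PerSmooth f) : Differentiable ℝ f :=
  hf.smooth.differentiable (by simp)

theorem per3.bounded {F : Type*} [NormedAddCommGroup F] {f : Pt → F} (hf : per3 f) (hc : Continuous f) :
    ∃ M, 0 ≤ M ∧ ∀ x, ‖f x‖ ≤ M := by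
  obtain ⟨M, hM⟩ := (isCompact_Icc (a := (0 : Pt)) (b := fun _ => 2 * π)).exists_bound_of_continuousOn
    hc.continuousOn
  have key : ∀ x, ‖f x‖ ≤ M := by
    intro x
    rw [← hf (fun i => -⌊x i / (2 * π)⌋) x]
    have h2 : (0 : ℝ) < 2 * π := by positivity
    apply hM
    constructor
    · intro i
      have := Int.floor_le (x i / (2 * π))
      rw [le_div_iff₀ h2] at this
      simp only [Pi.zero_apply, Pi.add_apply, Int.cast_neg]
      linarith
    · intro i
      have := (Int.lt_floor_add_one (x i / (2 * π))).le
      rw [div_le_iff₀ h2] at this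
      simp only [Pi.add_apply, Int.cast_neg]
      linarith
  exact ⟨M, (norm_nonneg _).trans (key 0), key⟩

theorem PerSmooth.bounded {f : Pt → E} (hf : PerSmooth f) : ∃ M, 0 ≤ M ∧ ∀ x, ‖f x‖ ≤ M :=
  hf.per.bounded hf.smooth.continuous

end Basic

/-- A weighted average of translates of `f`. -/
def avgOp {Θ E : Type*} [MeasurableSpace Θ] [NormedAddCommGroup E] [NormedSpace ℝ E]
    (μ : Measure Θ) (κ : Θ → ℝ) (v : Θ → Pt) (f : Pt → E) (x : Pt) : E :=
  ∫ θ, κ θ • f (x - v θ) ∂μ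

section AvgOp

variable {Θ : Type*} [MeasurableSpace Θ] {μ : Measure Θ} {κ : Θ → ℝ} {v : Θ → Pt}

theorem integrable_avgOp {E : Type*} [NormedAddCommGroup E] [NormedSpace ℝ E]
    (hκ : Integrable κ μ) (hv : Measurable v) {f : Pt → E} (hc : Continuous f) {M : ℝ}
    (hM : ∀ x, ‖f x‖ ≤ M) (x : Pt) : Integrable (fun θ => κ θ • f (x - v θ)) μ := by
  refine hκ.smul_bdd M ?_ (Filter.Eventually.of_forall fun θ => hM _)
  exact (hc.stronglyMeasurable.comp_measurable (measurable_const.sub hv)).aestronglyMeasurable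

theorem norm_avgOp_le {E : Type*} [NormedAddCommGroup E] [NormedSpace ℝ E]
    (hκ : Integrable κ μ) {f : Pt → E} {M : ℝ} (hM : ∀ x, ‖f x‖ ≤ M) (x : Pt) :
    ‖avgOp μ κ v f x‖ ≤ (∫ θ, |κ θ| ∂μ) * M := by
  rw [← integral_mul_const]
  refine norm_integral_le_of_norm_le (hκ.abs.mul_const _) (Filter.Eventually.of_forall fun θ => ?_)
  rw [norm_smul, Real.norm_eq_abs]
  exact mul_le_mul_of_nonneg_left (hM _) (abs_nonneg _)

theorem avgOp_hasFDerivAt {E : Type*} [NormedAddCommGroup E] [NormedSpace ℝ E]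
    (hκ : Integrable κ μ) (hv : Measurable v) {f : Pt → E} (hf : PerSmooth f) (x : Pt) :
    HasFDerivAt (avgOp μ κ v f) (avgOp μ κ v (fderiv ℝ f) x) x := by
  obtain ⟨M, -, hM⟩ := hf.bounded
  obtain ⟨M', -, hM'⟩ := hf.fderiv.bounded
  refine hasFDerivAt_integral_of_dominated_of_fderiv_le (s := Set.univ)
    (F := fun x θ => κ θ • f (x - v θ)) (F' := fun x θ => κ θ • fderiv ℝ f (x - v θ))
    (bound := fun θ => |κ θ| * M')
    Filter.univ_mem ?_ ?_ ?_ ?_ ?_ ?_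
  · exact Filter.Eventually.of_forall fun y =>
      (integrable_avgOp hκ hv hf.smooth.continuous hM y).aestronglyMeasurable
  · exact integrable_avgOp hκ hv hf.smooth.continuous hM x
  · exact (integrable_avgOp hκ hv hf.fderiv.smooth.continuous hM' x).aestronglyMeasurable
  · refine Filter.Eventually.of_forall fun θ y _ => ?_
    rw [norm_smul, Real.norm_eq_abs]
    exact mul_le_mul_of_nonneg_left (hM' _) (abs_nonneg _)
  · exact hκ.abs.mul_const _
  · refine Filter.Eventually.of_forall fun θ y _ => ?_
    have h := (hf.differentiable (y - v θ)).hasFDerivAt.comp y ((hasFDerivAt_id y).sub_const (v θ))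
    rw [ContinuousLinearMap.comp_id] at h
    exact h.const_smul (κ θ)

theorem contDiff_avgOp_nat (hκ : Integrable κ μ) (hv : Measurable v) (n : ℕ) :
    ∀ {E : Type} [NormedAddCommGroup E] [NormedSpace ℝ E] {f : Pt → E}, PerSmooth f →
      ContDiff ℝ n (avgOp μ κ v f) := by
  induction n with
  | zero =>
    intro E _ _ f hf
    exact contDiff_zero.2 (continuous_iff_continuousAt.2 fun x =>
      (avgOp_hasFDerivAt hκ hv hf x).continuousAt)
  | succ n ih =>
    intro E _ _ f hf
    have h : fderiv ℝ (avgOp μ κ v f) = avgOp μ κ v (fderiv ℝ f) :=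
      funext fun x => (avgOp_hasFDerivAt hκ hv hf x).fderiv
    push_cast
    refine contDiff_succ_iff_fderiv.2 ⟨fun x => (avgOp_hasFDerivAt hκ hv hf x).differentiableAt,
      by simp, ?_⟩
    rw [h]
    exact ih hf.fderiv

theorem PerSmooth.avgOp {E : Type} [NormedAddCommGroup E] [NormedSpace ℝ E]
    (hκ : Integrable κ μ) (hv : Measurable v) {f : Pt → E} (hf : PerSmooth f) :
    PerSmooth (avgOp μ κ v f) := by
  refine ⟨contDiff_infty.2 fun n => contDiff_avgOp_nat hκ hv n hf, fun l x => ?_⟩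
  simp only [_root_.avgOp]
  congr 1
  funext θ
  rw [add_sub_right_comm, hf.per]

theorem pd_avgOp {E : Type*} [NormedAddCommGroup E] [NormedSpace ℝ E] [CompleteSpace E]
    (hκ : Integrable κ μ) (hv : Measurable v) {f : Pt → E} (hf : PerSmooth f) (i : Fin 3) :
    pd i (avgOp μ κ v f) = avgOp μ κ v (pd i f) := by
  funext x
  obtain ⟨M', -, hM'⟩ := hf.fderiv.bounded
  rw [pd, (avgOp_hasFDerivAt hκ hv hf x).fderiv, avgOp, ContinuousLinearMap.integral_apply
    (integrable_avgOp hκ hv hf.fderiv.smooth.continuous hM' x)]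
  rfl

end AvgOp

/-! ### Integrals over the fundamental domain -/

theorem box3_ae_eq : Box3 =ᵐ[volume] Set.Icc (fun _ => -π : Pt) (fun _ => π) :=
  Measure.univ_pi_Ioc_ae_eq_Icc

theorem volume_box3 : volume.real Box3 = (2 * π) ^ 3 := by
  rw [measureReal_congr box3_ae_eq, Measure.real, Real.volume_Icc_pi_toReal]
  · simp; ring
  · intro i; simp; positivity

theorem integrableOn_box3 {E : Type*} [NormedAddCommGroup E] {f : Pt → E} (hf : Continuous f) :
    IntegrableOn f Box3 :=
  (integrableOn_congr_set_ae box3_ae_eq).2 hf.continuousOn.integrableOn_Icc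

theorem integral_box3_pd {E : Type*} [NormedAddCommGroup E] [NormedSpace ℝ E] [CompleteSpace E]
    {f : Pt → E} (hf : PerSmooth f) (i : Fin 3) : ∫ x in Box3, pd i f x = 0 := by
  rw [setIntegral_congr_set box3_ae_eq]
  have hle : (fun _ => -π : Pt) ≤ (fun _ => π) := fun _ => by simp; positivity
  have e : (fun x => ∑ j, (if j = i then fderiv ℝ f else 0) x (Pi.single j 1)) = pd i f := by
    funext x
    rw [Finset.sum_eq_single i]
    · simp [pd]
    · intro j _ hj; simp [hj]
    · simp
  have h := integral_divergence_of_hasFDerivAt_off_countable' (n := 2) (E := E)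
    (fun _ => -π : Pt) (fun _ => π) hle (fun j => if j = i then f else 0)
    (fun j => if j = i then fderiv ℝ f else 0) ∅ Set.countable_empty
    (fun j => by
      split_ifs
      · exact hf.smooth.continuous.continuousOn
      · exact continuousOn_const)
    (fun x _ j => by
      split_ifs
      · exact (hf.differentiable x).hasFDerivAt
      · exact hasFDerivAt_const 0 x)
    (by
      rw [e]
      exact (contDiff_pd hf.smooth i).continuous.continuousOn.integrableOn_Icc)
  rw [e] at h
  rw [h]
  refine Finset.sum_eq_zero fun j _ => ?_
  rw [sub_eq_zero]
  congr 1
  funext y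
  split_ifs
  · rw [← hf.per (Pi.single j 1) (j.insertNth (-π) y)]
    congr 1
    funext m
    refine Fin.succAboveCases j ?_ (fun m => ?_) m
    · simp; ring
    · simp
  · rfl

theorem clm_ext_pd {E : Type*} [NormedAddCommGroup E] [NormedSpace ℝ E] {A B : Pt →L[ℝ] E}
    (h : ∀ i : Fin 3, A (Pi.single i 1) = B (Pi.single i 1)) : A = B := by
  ext x
  have hx : x = ∑ i, x i • (Pi.single i (1 : ℝ) : Pt) := by
    funext j
    simp [Finset.sum_apply, Pi.single_apply]
  rw [hx]
  simp only [map_sum, map_smul, h]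

theorem integral_box3_fderiv {E : Type*} [NormedAddCommGroup E] [NormedSpace ℝ E]
    [CompleteSpace E] {f : Pt → E} (hf : PerSmooth f) : ∫ x in Box3, fderiv ℝ f x = 0 := by
  refine clm_ext_pd fun i => ?_
  rw [ContinuousLinearMap.integral_apply (integrableOn_box3 hf.fderiv.smooth.continuous)]
  exact integral_box3_pd hf i

theorem integral_box3_add {E : Type} [NormedAddCommGroup E] [NormedSpace ℝ E]
    [CompleteSpace E] {f : Pt → E} (hf : PerSmooth f) (z : Pt) :
    ∫ w in Box3, f (z + w) = ∫ w in Box3, f w := by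
  have hκ : Integrable (fun _ : Pt => (1 : ℝ)) (volume.restrict Box3) :=
    integrableOn_box3 continuous_const
  have hv : Measurable (fun w : Pt => -w) := measurable_neg
  have hG : PerSmooth (avgOp (volume.restrict Box3) (fun _ => (1 : ℝ)) (fun w => -w) f) :=
    hf.avgOp hκ hv
  have e : ∀ z, avgOp (volume.restrict Box3) (fun _ => (1 : ℝ)) (fun w => -w) f z
      = ∫ w in Box3, f (z + w) := fun z => by simp [avgOp]
  have key := is_const_of_fderiv_eq_zero (𝕜 := ℝ) hG.differentiable (fun z => by
    refine clm_ext_pd fun i => ?_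
    change pd i _ z = 0
    rw [pd_avgOp hκ hv hf i]
    have hs : PerSmooth (fun w => f (z + w)) :=
      ⟨hf.smooth.comp (contDiff_const.add contDiff_id), fun l x => by
        rw [← add_assoc, hf.per]⟩
    rw [← integral_box3_pd hs i]
    simp only [avgOp, one_smul, sub_neg_eq_add]
    congr 1
    funext w
    simp only [pd]
    rw [fderiv_comp_add_left]) z 0
  rw [e, e] at key
  simpa using key

theorem integral_box3_avgOp {Θ : Type*} [MeasurableSpace Θ] {μ : Measure Θ} [SFinite μ]
    {κ : Θ → ℝ} {v : Θ → Pt} (hκ : Integrable κ μ) (hv : Measurable v)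
    {E : Type} [NormedAddCommGroup E] [NormedSpace ℝ E] [CompleteSpace E] {f : Pt → E}
    (hf : PerSmooth f) (h0 : ∫ w in Box3, f w = 0) :
    ∫ w in Box3, avgOp μ κ v f w = 0 := by
  obtain ⟨M, -, hM⟩ := hf.bounded
  have h1 : Integrable (fun _ : Pt => (1 : ℝ)) (volume.restrict Box3) :=
    integrableOn_box3 continuous_const
  simp only [avgOp]
  rw [integral_integral_swap]
  · refine integral_eq_zero_of_ae (Filter.Eventually.of_forall fun θ => ?_)
    simp only [Pi.zero_apply]
    have := integral_box3_add hf (-v θ)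
    rw [integral_smul]
    simp only [neg_add_eq_sub] at this
    rw [this, h0, smul_zero]
  · have hi : Integrable (fun p : Pt × Θ => κ p.2) ((volume.restrict Box3).prod μ) := by
      simpa using h1.mul_prod hκ
    refine hi.smul_bdd M ?_ (Filter.Eventually.of_forall fun p => hM _)
    exact (hf.smooth.continuous.stronglyMeasurable.comp_measurable
      (measurable_fst.sub (hv.comp measurable_snd))).aestronglyMeasurable

/-! ### Translates of a smooth compactly supported kernel -/

theorem integrable_kernel {κ : Pt → ℝ} (hκ : ContDiff ℝ ∞ κ) (hs : HasCompactSupport κ) :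
    Integrable κ := hκ.continuous.integrable_of_hasCompactSupport hs

theorem integral_translate_sub_le {κ : Pt → ℝ} (hκ : ContDiff ℝ ∞ κ) (hs : HasCompactSupport κ) :
    ∃ K, 0 ≤ K ∧ ∀ α ∈ Set.Icc (0 : ℝ) 1, ∀ d : Pt, ∫ z, |κ (z + d) - κ z| ≤ K * ‖d‖ ^ α := by
  have hi := integrable_kernel hκ hs
  obtain ⟨C, hC⟩ := hκ.lipschitzWith_of_hasCompactSupport hs (by simp)
  obtain ⟨ρ, hρ⟩ := hs.isCompact.isBounded.subset_closedBall (0 : Pt)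
  set V := volume.real (Metric.closedBall (0 : Pt) (ρ + 1)) with hV
  refine ⟨max (C * V) (2 * ∫ z, |κ z|), ?_, fun α hα d => ?_⟩
  · exact le_max_of_le_left (by positivity)
  have hsub : Integrable (fun z => |κ (z + d) - κ z|) := ((hi.comp_add_right d).sub hi).abs
  rcases le_total ‖d‖ 1 with hd | hd
  · have hz : ∀ z ∉ Metric.closedBall (0 : Pt) (ρ + 1), |κ (z + d) - κ z| = 0 := by
      intro z hz
      rw [mem_closedBall_zero_iff, not_le] at hz
      have h1 : κ z = 0 := by
        by_contra hne
        have := hρ (subset_tsupport κ hne)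
        rw [mem_closedBall_zero_iff] at this
        linarith
      have h2 : κ (z + d) = 0 := by
        by_contra hne
        have := hρ (subset_tsupport κ hne)
        rw [mem_closedBall_zero_iff] at this
        have h3 := norm_sub_le (z + d) d
        rw [add_sub_cancel_right] at h3
        linarith
      simp [h1, h2]
    rw [← setIntegral_eq_integral_of_forall_compl_eq_zero hz]
    have hb : ∀ z ∈ Metric.closedBall (0 : Pt) (ρ + 1), |κ (z + d) - κ z| ≤ C * ‖d‖ := by
      intro z _
      have := hC.dist_le_mul (z + d) z
      rw [Real.dist_eq, dist_eq_norm, add_sub_cancel_left] at this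
      exact this
    have h4 := setIntegral_mono_on hsub.integrableOn
      (integrableOn_const (isCompact_closedBall (0 : Pt) (ρ + 1)).measure_lt_top.ne)
      measurableSet_closedBall hb
    rw [setIntegral_const, smul_eq_mul] at h4
    have h5 : ‖d‖ ≤ ‖d‖ ^ α := by
      simpa using Real.rpow_le_rpow_of_exponent_ge' (norm_nonneg d) hd hα.1 hα.2
    calc _ ≤ V * (C * ‖d‖) := h4
      _ = (C * V) * ‖d‖ := by ring
      _ ≤ max (C * V) (2 * ∫ z, |κ z|) * ‖d‖ ^ α := by
        gcongr
        exact le_max_left _ _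
  · have h1 : ∫ z, |κ (z + d) - κ z| ≤ 2 * ∫ z, |κ z| := by
      calc _ ≤ ∫ z, (|κ (z + d)| + |κ z|) :=
            integral_mono hsub ((hi.comp_add_right d).abs.add hi.abs) fun z => abs_sub _ _
        _ = (∫ z, |κ (z + d)|) + ∫ z, |κ z| := integral_add (hi.comp_add_right d).abs hi.abs
        _ = 2 * ∫ z, |κ z| := by rw [integral_add_right_eq_self (fun z => |κ z|)]; ring
    have h2 : 1 ≤ ‖d‖ ^ α := Real.one_le_rpow hd hα.1
    have h0 : 0 ≤ ∫ z, |κ z| := integral_nonneg fun z => abs_nonneg _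
    calc _ ≤ 2 * ∫ z, |κ z| := h1
      _ = (2 * ∫ z, |κ z|) * 1 := (mul_one _).symm
      _ ≤ max (C * V) (2 * ∫ z, |κ z|) * ‖d‖ ^ α := by
        gcongr
        exact le_max_right _ _

/-- Convolution with the kernel `κ` rescaled to length `t`. -/
def scaledOp {E : Type*} [NormedAddCommGroup E] [NormedSpace ℝ E] (κ : Pt → ℝ) (t : ℝ) :
    (Pt → E) → Pt → E := avgOp volume κ (fun y => t • y)

theorem measurable_smul_pt (t : ℝ) : Measurable (fun y : Pt => t • y) :=
  measurable_const_smul t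

theorem scaledOp_sub_le {κ : Pt → ℝ} (hκ : ContDiff ℝ ∞ κ) (hs : HasCompactSupport κ) :
    ∃ K, 0 ≤ K ∧ ∀ α ∈ Set.Icc (0 : ℝ) 1, ∀ t : ℝ, 0 < t →
      ∀ {E : Type} [NormedAddCommGroup E] [NormedSpace ℝ E] (f : Pt → E) (M : ℝ),
      Continuous f → (∀ x, ‖f x‖ ≤ M) →
      ∀ x y, ‖scaledOp κ t f x - scaledOp κ t f y‖ ≤ K * M * (‖x - y‖ / t) ^ α := by
  have hi := integrable_kernel hκ hs
  obtain ⟨K, hK0, hK⟩ := integral_translate_sub_le hκ hs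
  refine ⟨K, hK0, fun α hα t ht E _ _ f M hf hM x y => ?_⟩
  have hM0 : 0 ≤ M := (norm_nonneg _).trans (hM 0)
  have e : ∀ x, scaledOp κ t f x = ∫ z, κ (z + t⁻¹ • x) • f (-(t • z)) := by
    intro x
    rw [scaledOp, avgOp, ← integral_add_right_eq_self _ (t⁻¹ • x)]
    congr 1
    funext z
    rw [smul_add, smul_inv_smul₀ ht.ne', sub_add_cancel_right]
  have hint : ∀ x : Pt, Integrable (fun z => κ (z + t⁻¹ • x) • f (-(t • z))) := fun x =>
    (hi.comp_add_right (t⁻¹ • x)).smul_bdd M (by fun_prop)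
      (Filter.Eventually.of_forall fun z => hM _)
  rw [e, e, ← integral_sub (hint x) (hint y)]
  have hd : ‖t⁻¹ • (x - y)‖ = ‖x - y‖ / t := by
    rw [norm_smul, norm_inv, Real.norm_of_nonneg ht.le, inv_mul_eq_div]
  have hsub : Integrable (fun z => |κ (z + t⁻¹ • x) - κ (z + t⁻¹ • y)|) :=
    ((hi.comp_add_right _).sub (hi.comp_add_right _)).abs
  calc _ ≤ ∫ z, |κ (z + t⁻¹ • x) - κ (z + t⁻¹ • y)| * M := by
        refine norm_integral_le_of_norm_le (hsub.mul_const M)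
          (Filter.Eventually.of_forall fun z => ?_)
        rw [← sub_smul, norm_smul, Real.norm_eq_abs]
        exact mul_le_mul_of_nonneg_left (hM _) (abs_nonneg _)
    _ = (∫ z, |κ (z + t⁻¹ • (x - y)) - κ z|) * M := by
        rw [integral_mul_const,
          ← integral_add_right_eq_self (fun z => |κ (z + t⁻¹ • (x - y)) - κ z|) (t⁻¹ • y)]
        congr 2
        funext z
        rw [add_assoc, ← smul_add, add_sub_cancel]
    _ ≤ K * ‖t⁻¹ • (x - y)‖ ^ α * M := by
        gcongr
        exact hK α hα _
    _ = K * M * (‖x - y‖ / t) ^ α := by rw [hd]; ring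

theorem scaledOp_contraction {κ : Pt → ℝ} (hκ : ContDiff ℝ ∞ κ) (hs : HasCompactSupport κ)
    {ε : ℝ} (hε : 0 < ε) :
    ∃ L, 0 < L ∧ ∀ {E : Type} [NormedAddCommGroup E] [NormedSpace ℝ E] [CompleteSpace E]
      (f : Pt → E) (M : ℝ), PerSmooth f → ∫ w in Box3, f w = 0 → (∀ x, ‖f x‖ ≤ M) →
      ∀ x, ‖scaledOp κ L f x‖ ≤ ε * M := by
  obtain ⟨K, hK0, hK⟩ := scaledOp_sub_le hκ hs
  refine ⟨(K + 1) * π / ε, by positivity, fun {E} _ _ _ f M hf h0 hM x => ?_⟩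
  set L := (K + 1) * π / ε with hLdef
  have hL : 0 < L := by positivity
  have hi := integrable_kernel hκ hs
  have hM0 : 0 ≤ M := (norm_nonneg _).trans (hM 0)
  have hS : PerSmooth (scaledOp κ L f) := hf.avgOp hi (measurable_smul_pt L)
  have hz : ∫ w in Box3, scaledOp κ L f (x + w) = 0 := by
    rw [integral_box3_add hS]
    exact integral_box3_avgOp hi (measurable_smul_pt L) hf h0
  have hfin : volume Box3 ≠ ⊤ := by
    rw [measure_congr box3_ae_eq]
    exact isCompact_Icc.measure_lt_top.ne
  have hcont : Continuous fun w => scaledOp κ L f (x + w) := by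
    have := hS.smooth.continuous
    fun_prop
  have e : (2 * π) ^ 3 • scaledOp κ L f x
      = ∫ w in Box3, (scaledOp κ L f x - scaledOp κ L f (x + w)) := by
    have hc : Integrable (fun _ : Pt => scaledOp κ L f x) (volume.restrict Box3) :=
      integrableOn_box3 continuous_const
    rw [integral_sub hc (integrableOn_box3 hcont), hz, setIntegral_const, volume_box3, sub_zero]
  have hb : ∀ w ∈ Box3, ‖scaledOp κ L f x - scaledOp κ L f (x + w)‖ ≤ ε * M := by
    intro w hw
    have h1 := hK 1 ⟨zero_le_one, le_rfl⟩ L hL f M hf.smooth.continuous hM x (x + w)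
    have h2 : ‖x - (x + w)‖ ≤ π := by
      rw [sub_add_cancel_left, norm_neg]
      refine (pi_norm_le_iff_of_nonneg pi_pos.le).2 fun i => ?_
      have := hw i (Set.mem_univ i)
      rw [Real.norm_eq_abs, abs_le]
      exact ⟨this.1.le, this.2⟩
    rw [Real.rpow_one] at h1
    refine h1.trans ?_
    calc K * M * (‖x - (x + w)‖ / L) ≤ (K + 1) * M * (π / L) := by gcongr; linarith
      _ = ε * M := by rw [hLdef]; field_simp
  have h3 := norm_setIntegral_le_of_norm_le_const hfin.lt_top hb
  rw [← e, norm_smul, volume_box3, Real.norm_of_nonneg (by positivity), mul_comm] at h3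
  exact le_of_mul_le_mul_right h3 (by positivity)

/-! ### Neumann series -/

/-- The Neumann series of the operator of convolution with `κ` at scale `L`. -/
def neumann {E : Type*} [NormedAddCommGroup E] [NormedSpace ℝ E] (κ : Pt → ℝ) (L : ℝ)
    (f : Pt → E) (x : Pt) : E :=
  ∑' m : ℕ, (scaledOp κ L)^[m] f x

/-- Convolution with `κ` at scale `L` halves the sup norm of mean-zero functions. -/
def HalvesMeanZero (κ : Pt → ℝ) (L : ℝ) : Prop :=
  ∀ {E : Type} [NormedAddCommGroup E] [NormedSpace ℝ E] [CompleteSpace E]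
    (f : Pt → E) (M : ℝ), PerSmooth f → ∫ w in Box3, f w = 0 → (∀ x, ‖f x‖ ≤ M) →
    ∀ x, ‖scaledOp κ L f x‖ ≤ 1 / 2 * M

section Neumann

variable {κ : Pt → ℝ} {L : ℝ}

theorem scaledOp_iterate (hκ : Integrable κ) (hT : HalvesMeanZero κ L)
    {E : Type} [NormedAddCommGroup E] [NormedSpace ℝ E] [CompleteSpace E] {f : Pt → E}
    (hf : PerSmooth f) (h0 : ∫ w in Box3, f w = 0) {M : ℝ} (hM : ∀ x, ‖f x‖ ≤ M) (m : ℕ) :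
    PerSmooth ((scaledOp κ L)^[m] f) ∧ ∫ w in Box3, (scaledOp κ L)^[m] f w = 0 ∧
      ∀ x, ‖(scaledOp κ L)^[m] f x‖ ≤ (1 / 2) ^ m * M := by
  induction m with
  | zero => simpa using ⟨hf, h0, hM⟩
  | succ m ih =>
    obtain ⟨h1, h2, h3⟩ := ih
    simp only [Function.iterate_succ_apply']
    refine ⟨h1.avgOp hκ (measurable_smul_pt L),
      integral_box3_avgOp hκ (measurable_smul_pt L) h1 h2, fun x => ?_⟩
    refine (hT _ _ h1 h2 h3 x).trans (le_of_eq ?_)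
    ring

theorem fderiv_scaledOp_iterate (hκ : Integrable κ) (hT : HalvesMeanZero κ L)
    {E : Type} [NormedAddCommGroup E] [NormedSpace ℝ E] [CompleteSpace E] {f : Pt → E}
    (hf : PerSmooth f) (h0 : ∫ w in Box3, f w = 0) (m : ℕ) :
    fderiv ℝ ((scaledOp κ L)^[m] f) = (scaledOp κ L)^[m] (fderiv ℝ f) := by
  obtain ⟨M, -, hM⟩ := hf.bounded
  induction m with
  | zero => rfl
  | succ m ih =>
    rw [Function.iterate_succ_apply', Function.iterate_succ_apply', ← ih]
    exact funext fun x =>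
      (avgOp_hasFDerivAt hκ (measurable_smul_pt L) (scaledOp_iterate hκ hT hf h0 hM m).1 x).fderiv

theorem summable_half_pow_mul (M : ℝ) : Summable fun m : ℕ => (1 / 2 : ℝ) ^ m * M :=
  summable_geometric_two.mul_right M

theorem neumann_hasFDerivAt (hκ : Integrable κ) (hT : HalvesMeanZero κ L)
    {E : Type} [NormedAddCommGroup E] [NormedSpace ℝ E] [CompleteSpace E] {f : Pt → E}
    (hf : PerSmooth f) (h0 : ∫ w in Box3, f w = 0) (x : Pt) :
    HasFDerivAt (neumann κ L f) (neumann κ L (fderiv ℝ f) x) x := by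
  obtain ⟨M, -, hM⟩ := hf.bounded
  obtain ⟨M', -, hM'⟩ := hf.fderiv.bounded
  refine hasFDerivAt_tsum (summable_half_pow_mul M') (x₀ := x) (fun m y => ?_)
    (fun m y => (scaledOp_iterate hκ hT hf.fderiv (integral_box3_fderiv hf) hM' m).2.2 y)
    (.of_norm_bounded (summable_half_pow_mul M)
      fun m => (scaledOp_iterate hκ hT hf h0 hM m).2.2 x) x
  rw [← fderiv_scaledOp_iterate hκ hT hf h0]
  exact ((scaledOp_iterate hκ hT hf h0 hM m).1.differentiable y).hasFDerivAt

theorem contDiff_neumann_nat (hκ : Integrable κ) (hT : HalvesMeanZero κ L) (n : ℕ) :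
    ∀ {E : Type} [NormedAddCommGroup E] [NormedSpace ℝ E] [CompleteSpace E] {f : Pt → E},
      PerSmooth f → ∫ w in Box3, f w = 0 → ContDiff ℝ n (neumann κ L f) := by
  induction n with
  | zero =>
    intro E _ _ _ f hf h0
    exact contDiff_zero.2 (continuous_iff_continuousAt.2 fun x =>
      (neumann_hasFDerivAt hκ hT hf h0 x).continuousAt)
  | succ n ih =>
    intro E _ _ _ f hf h0
    have h : fderiv ℝ (neumann κ L f) = neumann κ L (fderiv ℝ f) :=
      funext fun x => (neumann_hasFDerivAt hκ hT hf h0 x).fderiv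
    push_cast
    refine contDiff_succ_iff_fderiv.2
      ⟨fun x => (neumann_hasFDerivAt hκ hT hf h0 x).differentiableAt, by simp, ?_⟩
    rw [h]
    exact ih hf.fderiv (integral_box3_fderiv hf)

theorem PerSmooth.neumann (hκ : Integrable κ) (hT : HalvesMeanZero κ L)
    {E : Type} [NormedAddCommGroup E] [NormedSpace ℝ E] [CompleteSpace E] {f : Pt → E}
    (hf : PerSmooth f) (h0 : ∫ w in Box3, f w = 0) : PerSmooth (neumann κ L f) := by
  obtain ⟨M, -, hM⟩ := hf.bounded
  refine ⟨contDiff_infty.2 fun n => contDiff_neumann_nat hκ hT n hf h0, fun l x => ?_⟩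
  simp only [_root_.neumann]
  congr 1
  funext m
  exact (scaledOp_iterate hκ hT hf h0 hM m).1.per l x

theorem norm_neumann_le (hκ : Integrable κ) (hT : HalvesMeanZero κ L)
    {E : Type} [NormedAddCommGroup E] [NormedSpace ℝ E] [CompleteSpace E] {f : Pt → E}
    (hf : PerSmooth f) (h0 : ∫ w in Box3, f w = 0) {M : ℝ} (hM : ∀ x, ‖f x‖ ≤ M) (x : Pt) :
    ‖neumann κ L f x‖ ≤ 2 * M :=
  tsum_of_norm_bounded (hasSum_geometric_two.mul_right M)
    fun m => (scaledOp_iterate hκ hT hf h0 hM m).2.2 x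

theorem neumann_sub_scaledOp (hκ : Integrable κ) (hT : HalvesMeanZero κ L)
    {E : Type} [NormedAddCommGroup E] [NormedSpace ℝ E] [CompleteSpace E] {f : Pt → E}
    (hf : PerSmooth f) (h0 : ∫ w in Box3, f w = 0) (x : Pt) :
    neumann κ L f x - scaledOp κ L (neumann κ L f) x = f x := by
  obtain ⟨M, hM0, hM⟩ := hf.bounded
  have hit := scaledOp_iterate hκ hT hf h0 hM
  have hint : ∀ m, Integrable (fun y => κ y • (scaledOp κ L)^[m] f (x - L • y)) := fun m =>
    integrable_avgOp hκ (measurable_smul_pt L) (hit m).1.smooth.continuous (hit m).2.2 x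
  have hsum : ∀ y, Summable fun m : ℕ => (scaledOp κ L)^[m] f y := fun y =>
    .of_norm_bounded (summable_half_pow_mul M) fun m => (hit m).2.2 y
  have h1 : HasSum (fun m : ℕ => ∫ y, κ y • (scaledOp κ L)^[m] f (x - L • y))
      (∫ y, ∑' m : ℕ, κ y • (scaledOp κ L)^[m] f (x - L • y)) := by
    refine hasSum_integral_of_summable_integral_norm hint ?_
    refine .of_nonneg_of_le (fun m => integral_nonneg fun y => norm_nonneg _) (fun m => ?_)
      (summable_half_pow_mul ((∫ y, |κ y|) * M))
    calc _ ≤ ∫ y, |κ y| * ((1 / 2) ^ m * M) := by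
          refine integral_mono (hint m).norm (hκ.abs.mul_const _) fun y => ?_
          simp only [norm_smul, Real.norm_eq_abs]
          exact mul_le_mul_of_nonneg_left ((hit m).2.2 _) (abs_nonneg _)
      _ = _ := by rw [integral_mul_const]; ring
  have h2 : scaledOp κ L (neumann κ L f) x = ∑' m : ℕ, (scaledOp κ L)^[m + 1] f x := by
    simp only [Function.iterate_succ_apply']
    refine Eq.trans ?_ h1.tsum_eq.symm
    simp only [scaledOp, avgOp, neumann]
    congr 1
    funext y
    exact ((hsum _).tsum_const_smul (κ y)).symm
  rw [h2, neumann, (hsum x).tsum_eq_zero_add]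
  simp

end Neumann

/-! ### Kernels -/

theorem exists_bump_one_dim :
    ∃ ρ : ℝ → ℝ, ContDiff ℝ ∞ ρ ∧ HasCompactSupport ρ ∧ 0 < ∫ s, ρ s := by
  obtain ⟨ρ⟩ : Nonempty (ContDiffBump (0 : ℝ)) := ⟨⟨1, 2, one_pos, one_lt_two⟩⟩
  exact ⟨ρ, ρ.contDiff, ρ.hasCompactSupport, ρ.integral_pos⟩

theorem exists_kernel_one_dim : ∃ χ ψ : ℝ → ℝ, ContDiff ℝ ∞ χ ∧ ContDiff ℝ ∞ ψ ∧
    HasCompactSupport χ ∧ HasCompactSupport ψ ∧ ∫ s, χ s ≠ 0 ∧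
    ∀ s, deriv (deriv ψ) s = -(s * χ s) := by
  obtain ⟨ρ, h0, s0, hpos⟩ := exists_bump_one_dim
  have h1 : ContDiff ℝ ∞ (deriv ρ) := (contDiff_infty_iff_deriv.1 h0).2
  have s1 : HasCompactSupport (deriv ρ) := s0.deriv
  have d0 : ∀ s, HasDerivAt ρ (deriv ρ s) s := fun s =>
    (h0.differentiable (by simp) s).hasDerivAt
  generalize deriv ρ = ρ₁ at *
  have h2 : ContDiff ℝ ∞ (deriv ρ₁) := (contDiff_infty_iff_deriv.1 h1).2
  have s2 : HasCompactSupport (deriv ρ₁) := s1.deriv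
  have d1 : ∀ s, HasDerivAt ρ₁ (deriv ρ₁ s) s := fun s =>
    (h1.differentiable (by simp) s).hasDerivAt
  generalize deriv ρ₁ = ρ₂ at *
  have e1 : deriv (fun s => s ^ 3 * ρ s) = fun s => 3 * s ^ 2 * ρ s + s ^ 3 * ρ₁ s := by
    funext s
    have := (hasDerivAt_pow 3 s).fun_mul (d0 s)
    rw [this.deriv]
    norm_num
  have e2 : ∀ s, deriv (fun s => 3 * s ^ 2 * ρ s + s ^ 3 * ρ₁ s) s
      = -(s * -(6 * ρ s + 6 * s * ρ₁ s + s ^ 2 * ρ₂ s)) := by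
    intro s
    have := (((hasDerivAt_pow 2 s).const_mul 3).fun_mul (d0 s)).fun_add
      ((hasDerivAt_pow 3 s).fun_mul (d1 s))
    rw [this.deriv]
    norm_num
    ring
  have hd : ∀ s, HasDerivAt (fun s => s ^ 2 * ρ₁ s + 4 * s * ρ s)
      (6 * s * ρ₁ s + s ^ 2 * ρ₂ s + 4 * ρ s) s := by
    intro s
    have := ((hasDerivAt_pow 2 s).fun_mul (d1 s)).fun_add
      (((hasDerivAt_id' s).const_mul 4).fun_mul (d0 s))
    refine this.congr_deriv ?_
    norm_num
    ring
  have i1 : Integrable (fun s => s ^ 2 * ρ₁ s + 4 * s * ρ s) :=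
    Continuous.integrable_of_hasCompactSupport (by fun_prop)
      ((s1.mul_left (f := fun s => s ^ 2)).add (s0.mul_left (f := fun s => 4 * s)))
  have i2 : Integrable (fun s => 6 * s * ρ₁ s + s ^ 2 * ρ₂ s + 4 * ρ s) :=
    Continuous.integrable_of_hasCompactSupport (by fun_prop)
      (((s1.mul_left (f := fun s => 6 * s)).add (s2.mul_left (f := fun s => s ^ 2))).add
        (s0.mul_left (f := fun _ => (4 : ℝ))))
  have i0 : Integrable (fun s => 2 * ρ s) :=
    (h0.continuous.integrable_of_hasCompactSupport s0).const_mul 2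
  have hz := integral_eq_zero_of_hasDerivAt_of_integrable hd i2 i1
  have e : (fun s => -(6 * ρ s + 6 * s * ρ₁ s + s ^ 2 * ρ₂ s))
      = fun s => -(2 * ρ s) - (6 * s * ρ₁ s + s ^ 2 * ρ₂ s + 4 * ρ s) := by
    funext s; ring
  have hI : ∫ s, -(6 * ρ s + 6 * s * ρ₁ s + s ^ 2 * ρ₂ s) ≠ 0 := by
    rw [e, integral_sub (f := fun s => -(2 * ρ s)) i0.neg i2, hz, integral_neg, integral_const_mul,
      sub_zero]
    intro h
    linarith
  have sχ : HasCompactSupport (fun s => -(6 * ρ s + 6 * s * ρ₁ s + s ^ 2 * ρ₂ s)) :=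
    (((s0.mul_left (f := fun _ => (6 : ℝ))).add (s1.mul_left (f := fun s => 6 * s))).add
      (s2.mul_left (f := fun s => s ^ 2))).neg
  have sψ : HasCompactSupport (fun s => s ^ 3 * ρ s) := s0.mul_left (f := fun s => s ^ 3)
  have hχ : ContDiff ℝ ∞ (fun s => -(6 * ρ s + 6 * s * ρ₁ s + s ^ 2 * ρ₂ s)) := by fun_prop
  have hψ : ContDiff ℝ ∞ (fun s => s ^ 3 * ρ s) := by fun_prop
  have hd2 : ∀ s, deriv (deriv fun s => s ^ 3 * ρ s) s
      = -(s * -(6 * ρ s + 6 * s * ρ₁ s + s ^ 2 * ρ₂ s)) := by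
    rw [e1]
    exact e2
  exact ⟨_, _, hχ, hψ, sχ, sψ, hI, hd2⟩

theorem pd_mul_const_coord {g : ℝ → ℝ} (hg : ContDiff ℝ ∞ g) (i : Fin 3) {c : Pt → ℝ}
    (hc : ContDiff ℝ ∞ c) (hci : ∀ y, pd i c y = 0) :
    pd i (fun y => g (y i) * c y) = fun y => deriv g (y i) * c y := by
  funext y
  have h1 : HasFDerivAt (fun y : Pt => g (y i))
      (deriv g (y i) • ContinuousLinearMap.proj (R := ℝ) (φ := fun _ : Fin 3 => ℝ) i) y :=
    ((hg.differentiable (by simp) (y i)).hasDerivAt).comp_hasFDerivAt y (hasFDerivAt_apply i y)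
  have h2 := (hc.differentiable (by simp) y).hasFDerivAt
  rw [pd, (h1.fun_mul h2).fderiv]
  have := hci y
  rw [pd] at this
  simp [this, mul_comm]

theorem pd_comp_coord_of_ne {g : ℝ → ℝ} (hg : ContDiff ℝ ∞ g) {i j : Fin 3} (hij : i ≠ j) (y : Pt) :
    pd i (fun y => g (y j)) y = 0 := by
  have h1 : HasFDerivAt (fun y : Pt => g (y j))
      (deriv g (y j) • ContinuousLinearMap.proj (R := ℝ) (φ := fun _ : Fin 3 => ℝ) j) y :=
    ((hg.differentiable (by simp) (y j)).hasDerivAt).comp_hasFDerivAt y (hasFDerivAt_apply j y)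
  rw [pd, h1.fderiv]
  simp [hij.symm]

theorem pd_mul {f g : Pt → ℝ} (hf : Differentiable ℝ f) (hg : Differentiable ℝ g) (i : Fin 3)
    (y : Pt) : pd i (fun y => f y * g y) y = f y * pd i g y + pd i f y * g y := by
  simp only [pd]
  rw [fderiv_fun_mul (hf y) (hg y)]
  simp [mul_comm]

theorem hasCompactSupport_prod_coord {g : Fin 3 → ℝ → ℝ} (hg : ∀ i, HasCompactSupport (g i)) :
    HasCompactSupport (fun y : Pt => ∏ i, g i (y i)) := by
  refine HasCompactSupport.intro (K := Set.univ.pi fun i => tsupport (g i))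
    (isCompact_univ_pi fun i => hg i) fun y hy => ?_
  simp only [Set.mem_pi, Set.mem_univ, true_implies, not_forall] at hy
  obtain ⟨i, hi⟩ := hy
  exact Finset.prod_eq_zero (Finset.mem_univ i) (image_eq_zero_of_notMem_tsupport hi)

theorem exists_kernel_three_dim : ∃ (η : Pt → ℝ) (β : Fin 3 → Pt → ℝ),
    ContDiff ℝ ∞ η ∧ HasCompactSupport η ∧ ∫ y, η y ≠ 0 ∧
    (∀ m, ContDiff ℝ ∞ (β m)) ∧ (∀ m, HasCompactSupport (β m)) ∧
    ∀ m y, pd m (pd m (β m)) y = -(y m * η y) := by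
  obtain ⟨χ, ψ, hχ, hψ, sχ, sψ, hI, hd⟩ := exists_kernel_one_dim
  have hψ' : ContDiff ℝ ∞ (deriv ψ) := (contDiff_infty_iff_deriv.1 hψ).2
  refine ⟨fun y => ∏ i, χ (y i), fun m y => ∏ i, (if i = m then ψ else χ) (y i), ?_,
    hasCompactSupport_prod_coord fun _ => sχ, ?_, fun m => ?_,
    fun m => hasCompactSupport_prod_coord fun i => by split_ifs <;> assumption, fun m y => ?_⟩
  · exact contDiff_prod fun i _ => hχ.comp (contDiff_apply ℝ ℝ i)
  · rw [integral_fintype_prod_volume_eq_prod (fun _ : Fin 3 => χ)]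
    exact Finset.prod_ne_zero_iff.2 fun _ _ => hI
  · refine contDiff_prod fun i _ => ?_
    split_ifs
    · exact hψ.comp (contDiff_apply ℝ ℝ i)
    · exact hχ.comp (contDiff_apply ℝ ℝ i)
  · have key : ∀ a b c : Fin 3, a ≠ b → a ≠ c → pd a (pd a fun y => ψ (y a) * (χ (y b) * χ (y c))) y
        = -(y a * (χ (y a) * (χ (y b) * χ (y c)))) := by
      intro a b c hab hac
      have hb : ContDiff ℝ ∞ (fun y : Pt => χ (y b)) := hχ.comp (contDiff_apply ℝ ℝ b)
      have hc : ContDiff ℝ ∞ (fun y : Pt => χ (y c)) := hχ.comp (contDiff_apply ℝ ℝ c)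
      have hz : ∀ y, pd a (fun y => χ (y b) * χ (y c)) y = 0 := fun y => by
        rw [pd_mul (hb.differentiable (by simp)) (hc.differentiable (by simp)),
          pd_comp_coord_of_ne hχ hab, pd_comp_coord_of_ne hχ hac]
        simp
      rw [pd_mul_const_coord hψ a (hb.mul hc) hz, pd_mul_const_coord hψ' a (hb.mul hc) hz]
      simp only [hd]
      ring
    fin_cases m
    · simpa [Fin.prod_univ_three, mul_assoc] using key 0 1 2 (by decide) (by decide)
    · have h := key 1 0 2 (by decide) (by decide)
      simp [Fin.prod_univ_three, mul_assoc, mul_left_comm] at h ⊢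
      linarith
    · have h := key 2 0 1 (by decide) (by decide)
      simp [Fin.prod_univ_three, mul_assoc, mul_comm, mul_left_comm] at h ⊢
      linarith

/-! ### Calculus of partial derivatives -/

section PdAlgebra

variable {E : Type*} [NormedAddCommGroup E] [NormedSpace ℝ E]

theorem pd_comm {f : Pt → E} (hf : ContDiff ℝ ∞ f) (i j : Fin 3) (x : Pt) :
    pd i (pd j f) x = pd j (pd i f) x := by
  have hd : Differentiable ℝ (fderiv ℝ f) :=
    (hf.fderiv_right (m := ∞) le_rfl).differentiable (by simp)
  have e : ∀ i j : Fin 3, pd i (pd j f) x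
      = fderiv ℝ (fderiv ℝ f) x (Pi.single i 1) (Pi.single j 1) := by
    intro i j
    have h := (hd x).hasFDerivAt.clm_apply (hasFDerivAt_const (Pi.single j (1 : ℝ) : Pt) x)
    change fderiv ℝ (fun y => fderiv ℝ f y (Pi.single j 1)) x _ = _
    rw [h.fderiv]
    simp
  rw [e, e]
  exact (hf.contDiffAt.isSymmSndFDerivAt
    (by simpa using WithTop.coe_le_coe.2 (le_top : (2 : ℕ∞) ≤ ⊤))).eq _ _

theorem pd_add {f g : Pt → E} (hf : Differentiable ℝ f) (hg : Differentiable ℝ g) (i : Fin 3)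
    (x : Pt) : pd i (fun y => f y + g y) x = pd i f x + pd i g x := by
  simp only [pd]
  rw [fderiv_fun_add (hf x) (hg x)]
  simp

theorem pd_sum {ι : Type*} (s : Finset ι) {f : ι → Pt → E} (hf : ∀ a, Differentiable ℝ (f a))
    (i : Fin 3) (x : Pt) : pd i (fun y => ∑ a ∈ s, f a y) x = ∑ a ∈ s, pd i (f a) x := by
  simp only [pd]
  rw [fderiv_fun_sum fun a _ => hf a x]
  simp

theorem pd_const_smul {𝕜 : Type*} [NormedField 𝕜] [NormedSpace 𝕜 E] [SMulCommClass ℝ 𝕜 E]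
    (c : 𝕜) {f : Pt → E} (hf : Differentiable ℝ f)
    (i : Fin 3) (x : Pt) : pd i (fun y => c • f y) x = c • pd i f x := by
  simp only [pd]
  rw [fderiv_fun_const_smul (hf x)]
  simp

end PdAlgebra

theorem HasCompactSupport.pd {f : Pt → ℝ} (hf : HasCompactSupport f) (i : Fin 3) :
    HasCompactSupport (pd i f) :=
  hf.fderiv_apply ℝ _

theorem hasCompactSupport_sum {ι : Type*} (s : Finset ι) {f : ι → Pt → ℝ}
    (hf : ∀ a, HasCompactSupport (f a)) : HasCompactSupport (fun y => ∑ a ∈ s, f a y) := by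
  classical
  induction s using Finset.induction_on with
  | empty =>
    simp only [Finset.sum_empty]
    exact HasCompactSupport.zero
  | insert a s ha ih =>
    simp only [Finset.sum_insert ha]
    exact (hf a).add ih

/-- Coefficients of a second-order operator valued in symmetric trace-free matrices whose
divergence is `∂ₘ³` in direction `l`. -/
def divCoeff (m l i j p q : Fin 3) : ℝ :=
  let δ : Fin 3 → Fin 3 → ℝ := fun a b => if a = b then 1 else 0
  if m = l then
    δ i m * δ j m * δ p m * δ q m + δ i m * δ p m * δ q j + δ j m * δ p m * δ q i
      - 1 / 2 * δ p i * δ q j - δ p q * δ i m * δ j m - δ p m * δ q m * δ i j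
      + 1 / 2 * δ p q * δ i j
  else
    δ p m * δ q m * (δ i m * δ j l + δ i l * δ j m) - δ p m * δ q l * δ i m * δ j m
      + δ p m * δ q l * δ i j - 1 / 2 * (δ i l * δ p m * δ q j + δ j l * δ p m * δ q i)
      - 1 / 2 * (δ i m * δ p l * δ q j + δ j m * δ p l * δ q i)
      + 1 / 2 * δ p q * (δ i m * δ j l + δ i l * δ j m)

theorem divCoeff_symm (D : Fin 3 → Fin 3 → ℝ) (hD : ∀ p q, D p q = D q p) (m l i j : Fin 3) :
    ∑ p, ∑ q, divCoeff m l i j p q * D p q = ∑ p, ∑ q, divCoeff m l j i p q * D p q := by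
  have h1 := hD 1 0
  have h2 := hD 2 0
  have h3 := hD 2 1
  fin_cases m <;> fin_cases l <;> fin_cases i <;> fin_cases j <;>
    simp [Fin.sum_univ_three, divCoeff, h1, h2, h3] <;> ring

theorem divCoeff_trace (D : Fin 3 → Fin 3 → ℝ) (hD : ∀ p q, D p q = D q p) (m l : Fin 3) :
    ∑ i, ∑ p, ∑ q, divCoeff m l i i p q * D p q = 0 := by
  have h1 := hD 1 0
  have h2 := hD 2 0
  have h3 := hD 2 1
  fin_cases m <;> fin_cases l <;> simp [Fin.sum_univ_three, divCoeff, h1, h2, h3] <;> ring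

theorem divCoeff_div (D : Fin 3 → Fin 3 → Fin 3 → ℝ) (h1 : ∀ j p q, D j p q = D j q p)
    (h2 : ∀ j p q, D j p q = D p j q) (m l i : Fin 3) :
    ∑ j, ∑ p, ∑ q, divCoeff m l i j p q * D j p q = if i = l then D m m m else 0 := by
  have a1 : D 0 1 0 = D 0 0 1 := h1 _ _ _
  have a2 : D 1 0 0 = D 0 0 1 := by rw [h2, h1]
  have a3 : D 0 2 0 = D 0 0 2 := h1 _ _ _
  have a4 : D 2 0 0 = D 0 0 2 := by rw [h2, h1]
  have a5 : D 1 0 1 = D 0 1 1 := h2 _ _ _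
  have a6 : D 1 1 0 = D 0 1 1 := by rw [h1, h2]
  have a7 : D 2 0 2 = D 0 2 2 := h2 _ _ _
  have a8 : D 2 2 0 = D 0 2 2 := by rw [h1, h2]
  have a9 : D 1 2 1 = D 1 1 2 := h1 _ _ _
  have b1 : D 2 1 1 = D 1 1 2 := by rw [h2, h1]
  have b2 : D 2 1 2 = D 1 2 2 := h2 _ _ _
  have b3 : D 2 2 1 = D 1 2 2 := by rw [h1, h2]
  have b4 : D 0 2 1 = D 0 1 2 := h1 _ _ _
  have b5 : D 1 0 2 = D 0 1 2 := h2 _ _ _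
  have b6 : D 1 2 0 = D 0 1 2 := by rw [h1, h2]
  have b7 : D 2 0 1 = D 0 1 2 := by rw [h2, h1]
  have b8 : D 2 1 0 = D 0 1 2 := by rw [h1, h2, h1]
  fin_cases m <;> fin_cases l <;> fin_cases i <;>
    simp [Fin.sum_univ_three, divCoeff, a1, a2, a3, a4, a5, a6, a7, a8, a9, b1, b2, b3, b4, b5,
      b6, b7, b8] <;> ring_nf <;> simp

theorem exists_div_kernel : ∃ (η : Pt → ℝ) (κ : Fin 3 → Fin 3 → Fin 3 → Pt → ℝ),
    ContDiff ℝ ∞ η ∧ HasCompactSupport η ∧ ∫ y, η y = 1 ∧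
    (∀ l i j, ContDiff ℝ ∞ (κ l i j)) ∧ (∀ l i j, HasCompactSupport (κ l i j)) ∧
    (∀ l i j, κ l i j = κ l j i) ∧ (∀ l y, ∑ i, κ l i i y = 0) ∧
    ∀ l i y, ∑ j, pd j (κ l i j) y = if i = l then -∑ m, pd m (fun y => y m * η y) y else 0 := by
  obtain ⟨η₀, β₀, hη₀, sη₀, hI, hβ₀, sβ₀, hd₀⟩ := exists_kernel_three_dim
  obtain ⟨η, β, hη, sη, hI1, hβ, sβ, hd⟩ : ∃ (η : Pt → ℝ) (β : Fin 3 → Pt → ℝ),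
      ContDiff ℝ ∞ η ∧ HasCompactSupport η ∧ ∫ y, η y = 1 ∧
      (∀ m, ContDiff ℝ ∞ (β m)) ∧ (∀ m, HasCompactSupport (β m)) ∧
      ∀ m, pd m (pd m (β m)) = fun y => -(y m * η y) := by
    refine ⟨fun y => (∫ y, η₀ y)⁻¹ • η₀ y, fun m y => (∫ y, η₀ y)⁻¹ • β₀ m y,
      contDiff_const.fun_smul hη₀, sη₀.smul_left (f := fun _ => (∫ y, η₀ y)⁻¹), ?_,
      fun m => contDiff_const.fun_smul (hβ₀ m),
      fun m => (sβ₀ m).smul_left (f := fun _ => (∫ y, η₀ y)⁻¹), fun m => ?_⟩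
    · rw [integral_smul, smul_eq_mul, inv_mul_cancel₀ hI]
    · have h1 := pd_const_smul (∫ y, η₀ y)⁻¹ ((hβ₀ m).differentiable (by simp)) m
      have h2 := pd_const_smul (∫ y, η₀ y)⁻¹
        ((contDiff_pd (hβ₀ m) m).differentiable (by simp)) m
      funext y
      rw [funext h1, h2, hd₀]
      simp only [smul_eq_mul]
      ring
  have hD : ∀ m p q, ContDiff ℝ ∞ (pd p (pd q (β m))) := fun m p q =>
    contDiff_pd (contDiff_pd (hβ m) q) p
  have hDd : ∀ m p q, Differentiable ℝ (pd p (pd q (β m))) := fun m p q =>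
    (hD m p q).differentiable (by simp)
  have hs : ∀ m y p q, pd p (pd q (β m)) y = pd q (pd p (β m)) y := fun m y p q =>
    pd_comm (hβ m) p q y
  refine ⟨η, fun l i j y => ∑ m, ∑ p, ∑ q, divCoeff m l i j p q * pd p (pd q (β m)) y,
    hη, sη, hI1, fun l i j => ?_, fun l i j => ?_, fun l i j => ?_, fun l y => ?_,
    fun l i y => ?_⟩
  · exact ContDiff.sum fun m _ => ContDiff.sum fun p _ => ContDiff.sum fun q _ =>
      contDiff_const.mul (hD m p q)
  · exact hasCompactSupport_sum _ fun m => hasCompactSupport_sum _ fun p =>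
      hasCompactSupport_sum _ fun q => (((sβ m).pd q).pd p).mul_left
  · funext y
    exact Finset.sum_congr rfl fun m _ =>
      divCoeff_symm (fun p q => pd p (pd q (β m)) y) (hs m y) m l i j
  · rw [Finset.sum_comm]
    exact Finset.sum_eq_zero fun m _ =>
      divCoeff_trace (fun p q => pd p (pd q (β m)) y) (hs m y) m l
  · have e : ∀ j, pd j (fun y => ∑ m, ∑ p, ∑ q, divCoeff m l i j p q * pd p (pd q (β m)) y) y
        = ∑ m, ∑ p, ∑ q, divCoeff m l i j p q * pd j (pd p (pd q (β m))) y := by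
      intro j
      have d1 : ∀ m p q, Differentiable ℝ
          (fun y => divCoeff m l i j p q * pd p (pd q (β m)) y) := fun m p q =>
        (hDd m p q).const_mul _
      have d2 : ∀ m p, Differentiable ℝ
          (fun y => ∑ q, divCoeff m l i j p q * pd p (pd q (β m)) y) := fun m p =>
        Differentiable.fun_sum fun q _ => d1 m p q
      have d3 : ∀ m, Differentiable ℝ
          (fun y => ∑ p, ∑ q, divCoeff m l i j p q * pd p (pd q (β m)) y) := fun m =>
        Differentiable.fun_sum fun p _ => d2 m p
      rw [pd_sum _ d3]
      refine Finset.sum_congr rfl fun m _ => ?_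
      rw [pd_sum _ (d2 m)]
      refine Finset.sum_congr rfl fun p _ => ?_
      rw [pd_sum _ (d1 m p)]
      refine Finset.sum_congr rfl fun q _ => ?_
      exact pd_const_smul (divCoeff m l i j p q) (hDd m p q) j y
    simp only [e]
    rw [Finset.sum_comm]
    have e2 : ∀ m, ∑ j, ∑ p, ∑ q, divCoeff m l i j p q * pd j (pd p (pd q (β m))) y
        = if i = l then pd m (pd m (pd m (β m))) y else 0 := fun m =>
      divCoeff_div (fun j p q => pd j (pd p (pd q (β m))) y)
        (fun j p q => by rw [funext fun z => hs m z p q])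
        (fun j p q => pd_comm (contDiff_pd (hβ m) q) j p y) m l i
    simp only [e2]
    split_ifs
    · rw [← Finset.sum_neg_distrib]
      refine Finset.sum_congr rfl fun m _ => ?_
      rw [hd m]
      have : Differentiable ℝ fun y : Pt => y m * η y :=
        (differentiable_apply m).fun_mul (hη.differentiable (by simp))
      simp only [pd, fderiv_fun_neg]
      rfl
    · simp

/-! ### Scale-integrated convolutions -/

theorem fderiv_eq_sum_pd {E : Type*} [NormedAddCommGroup E] [NormedSpace ℝ E] (f : Pt → E)
    (x y : Pt) : fderiv ℝ f x y = ∑ m, y m • pd m f x := by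
  have hx : y = ∑ i, y i • (Pi.single i (1 : ℝ) : Pt) := by
    funext j
    simp [Finset.sum_apply, Pi.single_apply]
  conv_lhs => rw [hx]
  simp only [map_sum, map_smul, pd]

theorem norm_pd_le {E : Type*} [NormedAddCommGroup E] [NormedSpace ℝ E] (f : Pt → E)
    (i : Fin 3) (x : Pt) : ‖pd i f x‖ ≤ ‖fderiv ℝ f x‖ := by
  have := (fderiv ℝ f x).le_opNorm (Pi.single i 1)
  rwa [Pi.norm_single, norm_one, mul_one] at this

section ScaleIntegral

variable {E : Type} [NormedAddCommGroup E] [NormedSpace ℝ E]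

theorem smul_scaledOp_pd {κ : Pt → ℝ} (hκ : ContDiff ℝ ∞ κ) (hs : HasCompactSupport κ)
    {F : Pt → E} (hF : PerSmooth F) (t : ℝ) (j : Fin 3) (x : Pt) :
    t • scaledOp κ t (pd j F) x = scaledOp (pd j κ) t F x := by
  have hi := integrable_kernel hκ hs
  have hi' := integrable_kernel (contDiff_pd hκ j) (hs.pd j)
  obtain ⟨M, -, hM⟩ := hF.bounded
  obtain ⟨M', -, hM'⟩ := (hF.pd j).bounded
  set G : Pt → E := fun y => F (x - t • y) with hG
  have hd : ∀ y, HasFDerivAt G ((fderiv ℝ F (x - t • y)).comp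
      (-(t • ContinuousLinearMap.id ℝ Pt))) y := fun y =>
    (hF.differentiable _).hasFDerivAt.comp y
      (((hasFDerivAt_id y).const_smul t).const_sub x)
  have e : ∀ y, fderiv ℝ G y (Pi.single j 1) = -(t • pd j F (x - t • y)) := by
    intro y
    rw [(hd y).fderiv]
    simp [pd]
  have i1 : Integrable fun y => κ y • pd j F (x - t • y) :=
    integrable_avgOp hi (measurable_smul_pt t) (hF.pd j).smooth.continuous hM' x
  have h := integral_smul_fderiv_eq_neg_fderiv_smul_of_integrable (μ := (volume : Measure Pt))
    (f := κ) (g := G) (v := Pi.single j 1)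
    (integrable_avgOp hi' (measurable_smul_pt t) hF.smooth.continuous hM x)
    (by
      simp only [e]
      have := (i1.smul t).neg
      refine this.congr (Filter.Eventually.of_forall fun y => ?_)
      simp only [Pi.neg_apply, Pi.smul_apply, smul_neg]
      rw [smul_comm])
    (integrable_avgOp hi (measurable_smul_pt t) hF.smooth.continuous hM x)
    (fun y _ => hκ.differentiable (by simp) y) (fun y _ => (hd y).differentiableAt)
  simp only [e, smul_neg, integral_neg, neg_inj] at h
  rw [scaledOp, avgOp, ← integral_smul]
  simp only [smul_comm t]
  exact h

theorem hasDerivAt_scaledOp {η : Pt → ℝ} (hη : ContDiff ℝ ∞ η) (hs : HasCompactSupport η)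
    {F : Pt → E} (hF : PerSmooth F) (x : Pt) (t : ℝ) :
    HasDerivAt (fun t => scaledOp η t F x)
      (-∑ m, scaledOp (fun y => y m * η y) t (pd m F) x) t := by
  have hi := integrable_kernel hη hs
  have hi' : ∀ m : Fin 3, Integrable (fun y : Pt => y m * η y) := fun m =>
    integrable_kernel ((contDiff_apply ℝ ℝ m).mul hη) hs.mul_left
  obtain ⟨M, -, hM⟩ := hF.bounded
  obtain ⟨M', -, hM'⟩ := hF.fderiv.bounded
  have hMp : ∀ m x, ‖pd m F x‖ ≤ M' := fun m x => (norm_pd_le F m x).trans (hM' x)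
  have hj : ∀ (t : ℝ) (m : Fin 3), Integrable fun y : Pt => (y m * η y) • pd m F (x - t • y) :=
    fun t m => integrable_avgOp (hi' m) (measurable_smul_pt t) (hF.pd m).smooth.continuous
      (hMp m) x
  have h := hasDerivAt_integral_of_dominated_loc_of_deriv_le (μ := (volume : Measure Pt))
    (F := fun t y => η y • F (x - t • y))
    (F' := fun t y => -∑ m, (y m * η y) • pd m F (x - t • y))
    (x₀ := t) (s := Set.univ) (bound := fun y => ∑ m, |y m * η y| * M') Filter.univ_mem
    (Filter.Eventually.of_forall fun t => (integrable_avgOp hi (measurable_smul_pt t)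
      hF.smooth.continuous hM x).aestronglyMeasurable)
    (integrable_avgOp hi (measurable_smul_pt t) hF.smooth.continuous hM x)
    (integrable_finsetSum _ fun m _ => hj t m).neg.aestronglyMeasurable
    (Filter.Eventually.of_forall fun y t _ => by
      rw [norm_neg]
      refine norm_sum_le_of_le _ fun m _ => ?_
      rw [norm_smul, Real.norm_eq_abs]
      exact mul_le_mul_of_nonneg_left (hMp m _) (abs_nonneg _))
    (integrable_finsetSum _ fun m _ => (hi' m).abs.mul_const M')
    (Filter.Eventually.of_forall fun y t _ => by
      have h1 : HasDerivAt (fun t : ℝ => x - t • y) (-y) t := by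
        simpa using ((hasDerivAt_id t).smul_const y).const_sub x
      have h2 := ((hF.differentiable (x - t • y)).hasFDerivAt.comp_hasDerivAt t h1).const_smul (η y)
      refine h2.congr_deriv ?_
      rw [map_neg, fderiv_eq_sum_pd, smul_neg, Finset.smul_sum]
      congr 1
      refine Finset.sum_congr rfl fun m _ => ?_
      rw [smul_smul, mul_comm])
  refine h.2.congr_deriv ?_
  rw [integral_neg, integral_finsetSum _ fun m _ => hj t m]
  rfl

/-- The integral over scales `0 < t ≤ L` of the convolutions with `κ` rescaled to `t`. -/
def timeOp (κ : Pt → ℝ) (L : ℝ) : (Pt → E) → Pt → E :=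
  avgOp ((volume.restrict (Set.Ioc 0 L)).prod volume) (fun p : ℝ × Pt => κ p.2)
    (fun p => p.1 • p.2)

theorem integrable_timeKernel {κ : Pt → ℝ} (hκ : Integrable κ) (L : ℝ) :
    Integrable (fun p : ℝ × Pt => κ p.2)
      ((volume.restrict (Set.Ioc 0 L)).prod (volume : Measure Pt)) := by
  have h : Integrable (fun _ : ℝ => (1 : ℝ)) (volume.restrict (Set.Ioc 0 L)) :=
    (continuous_const.integrableOn_Ioc : IntegrableOn _ _ _)
  simpa using h.mul_prod hκ

theorem measurable_timeShift : Measurable (fun p : ℝ × Pt => p.1 • p.2) :=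
  measurable_fst.smul measurable_snd

theorem integrable_timeOp {κ : Pt → ℝ} (hκ : Integrable κ) (L : ℝ) {F : Pt → E}
    (hF : PerSmooth F) (x : Pt) : Integrable (fun p : ℝ × Pt => κ p.2 • F (x - p.1 • p.2))
      ((volume.restrict (Set.Ioc 0 L)).prod (volume : Measure Pt)) := by
  obtain ⟨M, -, hM⟩ := hF.bounded
  exact integrable_avgOp (integrable_timeKernel hκ L) measurable_timeShift
    hF.smooth.continuous hM x

theorem timeOp_eq {κ : Pt → ℝ} (hκ : Integrable κ) (L : ℝ) {F : Pt → E}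
    (hF : PerSmooth F) (x : Pt) :
    timeOp κ L F x = ∫ t in Set.Ioc 0 L, scaledOp κ t F x :=
  integral_prod _ (integrable_timeOp hκ L hF x)

theorem integrableOn_scaledOp {κ : Pt → ℝ} (hκ : Integrable κ) (L : ℝ) {F : Pt → E}
    (hF : PerSmooth F) (x : Pt) : IntegrableOn (fun t => scaledOp κ t F x) (Set.Ioc 0 L) :=
  (integrable_timeOp hκ L hF x).integral_prod_left

theorem scaledOp_sum {ι : Type*} (s : Finset ι) {κ : ι → Pt → ℝ} (hκ : ∀ a, Integrable (κ a))
    {F : Pt → E} (hF : PerSmooth F) (t : ℝ) (x : Pt) :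
    scaledOp (fun y => ∑ a ∈ s, κ a y) t F x = ∑ a ∈ s, scaledOp (κ a) t F x := by
  obtain ⟨M, -, hM⟩ := hF.bounded
  simp only [scaledOp, avgOp, Finset.sum_smul]
  exact integral_finsetSum _ fun a _ =>
    integrable_avgOp (hκ a) (measurable_smul_pt t) hF.smooth.continuous hM x

theorem sum_pd_timeOp {η : Pt → ℝ} (hη : ContDiff ℝ ∞ η) (sη : HasCompactSupport η)
    {κ : Fin 3 → Pt → ℝ} (hκ : ∀ j, ContDiff ℝ ∞ (κ j)) (sκ : ∀ j, HasCompactSupport (κ j))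
    (hdiv : ∀ y, ∑ j, pd j (κ j) y = -∑ m, pd m (fun y => y m * η y) y)
    {L : ℝ} (hL : 0 ≤ L) [CompleteSpace E] {F : Pt → E} (hF : PerSmooth F) (x : Pt) :
    ∑ j, pd j (timeOp (κ j) L F) x = scaledOp η L F x - (∫ y, η y) • F x := by
  have hi : ∀ j, Integrable (κ j) := fun j => integrable_kernel (hκ j) (sκ j)
  have hη' : ∀ m : Fin 3, ContDiff ℝ ∞ (fun y : Pt => y m * η y) := fun m =>
    (contDiff_apply ℝ ℝ m).mul hη
  have sη' : ∀ m : Fin 3, HasCompactSupport (fun y : Pt => y m * η y) := fun m => sη.mul_left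
  have hi' : ∀ m : Fin 3, Integrable (fun y : Pt => y m * η y) := fun m =>
    integrable_kernel (hη' m) (sη' m)
  have hpd : ∀ j, pd j (timeOp (κ j) L F) x = timeOp (κ j) L (pd j F) x := fun j =>
    congrFun (pd_avgOp (integrable_timeKernel (hi j) L) measurable_timeShift hF j) x
  have key : ∀ t, 0 < t → ∑ j, scaledOp (κ j) t (pd j F) x
      = -∑ m, scaledOp (fun y => y m * η y) t (pd m F) x := by
    intro t ht
    have h1 : t • ∑ j, scaledOp (κ j) t (pd j F) x
        = t • -∑ m, scaledOp (fun y => y m * η y) t (pd m F) x := by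
      rw [smul_neg, Finset.smul_sum, Finset.smul_sum,
        Finset.sum_congr rfl fun j _ => smul_scaledOp_pd (hκ j) (sκ j) hF t j x,
        Finset.sum_congr rfl fun m _ => smul_scaledOp_pd (hη' m) (sη' m) hF t m x,
        ← scaledOp_sum _ (fun j => integrable_kernel (contDiff_pd (hκ j) j) ((sκ j).pd j)) hF,
        ← scaledOp_sum _ (fun j => integrable_kernel (contDiff_pd (hη' j) j) ((sη' j).pd j)) hF,
        funext hdiv]
      simp only [scaledOp, avgOp, neg_smul, integral_neg]
    exact smul_right_injective E ht.ne' h1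
  have hint : IntervalIntegrable (fun t => -∑ m, scaledOp (fun y => y m * η y) t (pd m F) x)
      volume 0 L := by
    rw [intervalIntegrable_iff_integrableOn_Ioc_of_le hL]
    exact (integrable_finsetSum _ fun m _ => integrableOn_scaledOp (hi' m) L (hF.pd m) x).neg
  have hftc := intervalIntegral.integral_eq_sub_of_hasDerivAt
    (fun t _ => hasDerivAt_scaledOp hη sη hF x t) hint
  have h0 : scaledOp η 0 F x = (∫ y, η y) • F x := by
    simp only [scaledOp, avgOp, zero_smul, sub_zero]
    exact integral_smul_const _ _
  rw [h0, intervalIntegral.integral_of_le hL] at hftc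
  rw [← hftc, Finset.sum_congr rfl fun j _ => (hpd j).trans (timeOp_eq (hi j) L (hF.pd j) x),
    ← integral_finsetSum _ fun j _ => integrableOn_scaledOp (hi j) L (hF.pd j) x]
  exact setIntegral_congr_fun measurableSet_Ioc fun t ht => key t ht.1

theorem timeOp_sub_le {κ : Pt → ℝ} (hκ : ContDiff ℝ ∞ κ) (hs : HasCompactSupport κ)
    {α : ℝ} (hα : α ∈ Set.Ioo (0 : ℝ) 1) {L : ℝ} (hL : 0 ≤ L) :
    ∃ K, 0 ≤ K ∧ ∀ {E : Type} [NormedAddCommGroup E] [NormedSpace ℝ E] [CompleteSpace E]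
      (F : Pt → E) (M : ℝ), PerSmooth F → (∀ x, ‖F x‖ ≤ M) →
      ∀ x y, ‖timeOp κ L F x - timeOp κ L F y‖ ≤ K * M * ‖x - y‖ ^ α := by
  obtain ⟨K, hK0, hK⟩ := scaledOp_sub_le hκ hs
  have hi := integrable_kernel hκ hs
  have hint : IntegrableOn (fun t : ℝ => t ^ (-α)) (Set.Ioc 0 L) :=
    (intervalIntegrable_iff_integrableOn_Ioc_of_le hL).1
      (intervalIntegral.intervalIntegrable_rpow' (by linarith [hα.2]))
  have hJ : 0 ≤ ∫ t in Set.Ioc 0 L, t ^ (-α) :=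
    setIntegral_nonneg measurableSet_Ioc fun t ht => Real.rpow_nonneg ht.1.le _
  refine ⟨K * ∫ t in Set.Ioc 0 L, t ^ (-α), mul_nonneg hK0 hJ, fun {E} _ _ _ F M hF hM x y => ?_⟩
  rw [timeOp_eq hi L hF, timeOp_eq hi L hF,
    ← integral_sub (integrableOn_scaledOp hi L hF x) (integrableOn_scaledOp hi L hF y)]
  have hb : ∀ t ∈ Set.Ioc 0 L, ‖scaledOp κ t F x - scaledOp κ t F y‖
      ≤ K * M * ‖x - y‖ ^ α * t ^ (-α) := by
    intro t ht
    refine (hK α ⟨hα.1.le, hα.2.le⟩ t ht.1 F M hF.smooth.continuous hM x y).trans (le_of_eq ?_)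
    rw [Real.div_rpow (norm_nonneg _) ht.1.le, Real.rpow_neg ht.1.le]
    ring
  refine (norm_integral_le_of_norm_le (hint.const_mul _)
    ((ae_restrict_iff' measurableSet_Ioc).2 (Filter.Eventually.of_forall hb))).trans (le_of_eq ?_)
  rw [integral_const_mul]
  ring

end ScaleIntegral

/-! ### A bounded right inverse of the divergence -/

section PerSmoothAlgebra

variable {E : Type*} [NormedAddCommGroup E] [NormedSpace ℝ E]

theorem perSmooth_const (c : E) : PerSmooth (fun _ : Pt => c) :=
  ⟨contDiff_const, fun _ _ => rfl⟩

theorem PerSmooth.add {f g : Pt → E} (hf : PerSmooth f) (hg : PerSmooth g) :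
    PerSmooth (fun x => f x + g x) :=
  ⟨hf.smooth.add hg.smooth, fun l x => by simp only [hf.per l x, hg.per l x]⟩

theorem PerSmooth.neg {f : Pt → E} (hf : PerSmooth f) : PerSmooth (fun x => -f x) :=
  ⟨hf.smooth.neg, fun l x => by simp only [hf.per l x]⟩

theorem PerSmooth.sub {f g : Pt → E} (hf : PerSmooth f) (hg : PerSmooth g) :
    PerSmooth (fun x => f x - g x) :=
  ⟨hf.smooth.sub hg.smooth, fun l x => by simp only [hf.per l x, hg.per l x]⟩

theorem PerSmooth.sum {ι : Type*} (s : Finset ι) {f : ι → Pt → E} (hf : ∀ a, PerSmooth (f a)) :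
    PerSmooth (fun x => ∑ a ∈ s, f a x) :=
  ⟨ContDiff.sum fun a _ => (hf a).smooth, fun l x =>
    Finset.sum_congr rfl fun a _ => (hf a).per l x⟩

theorem pd_neg (f : Pt → E) (i : Fin 3) (x : Pt) : pd i (fun y => -f y) x = -pd i f x := by
  simp only [pd, fderiv_fun_neg]
  rfl

end PerSmoothAlgebra

theorem exists_div_inverse {α : ℝ} (hα : α ∈ Set.Ioo (0 : ℝ) 1) :
    ∃ K, 0 ≤ K ∧ ∀ (r : Fin 3 → Pt → ℂ) (A : ℝ), (∀ i, PerSmooth (r i)) →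
      (∀ i x, ‖r i x‖ ≤ A) →
      ∃ (R : Fin 3 → Fin 3 → Pt → ℂ) (m : Fin 3 → ℂ), (∀ i j, PerSmooth (R i j)) ∧
        (∀ i j, R i j = R j i) ∧ (∀ x, ∑ i, R i i x = 0) ∧
        (∀ i x, ∑ j, pd j (R i j) x = r i x - m i) ∧
        (∀ i j x, ‖R i j x‖ ≤ K * A) ∧
        ∀ i j x y, ‖R i j x - R i j y‖ ≤ K * A * ‖x - y‖ ^ α := by
  obtain ⟨η, κ, hη, sη, hI, hκ, sκ, hsymm, htr, hdiv⟩ := exists_div_kernel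
  obtain ⟨L, hL, hT⟩ := scaledOp_contraction hη sη (show (0 : ℝ) < 1 / 2 by norm_num)
  replace hT : HalvesMeanZero η L := hT
  have hiη := integrable_kernel hη sη
  have hiκ : ∀ l i j, Integrable (κ l i j) := fun l i j => integrable_kernel (hκ l i j) (sκ l i j)
  choose H hH0 hH using fun l i j => timeOp_sub_le (hκ l i j) (sκ l i j) hα hL.le
  let J : Fin 3 → Fin 3 → Fin 3 → ℝ := fun l i j =>
    ∫ p, |κ l i j p.2| ∂((volume.restrict (Set.Ioc 0 L)).prod (volume : Measure Pt))
  have hJ0 : ∀ l i j, 0 ≤ J l i j := fun l i j => integral_nonneg fun p => abs_nonneg _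
  let K : ℝ := ∑ l, ∑ i, ∑ j, (H l i j + J l i j)
  have hHJ : ∀ l i j, 0 ≤ H l i j + J l i j := fun l i j => add_nonneg (hH0 l i j) (hJ0 l i j)
  have hKs : ∀ i j, ∑ l, (H l i j + J l i j) ≤ K := by
    intro i j
    refine Finset.sum_le_sum fun l _ => ?_
    calc _ ≤ ∑ j, (H l i j + J l i j) :=
          Finset.single_le_sum (f := fun j => H l i j + J l i j) (fun j _ => hHJ l i j)
            (Finset.mem_univ j)
      _ ≤ _ := Finset.single_le_sum (f := fun i => ∑ j, (H l i j + J l i j))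
          (fun i _ => Finset.sum_nonneg fun j _ => hHJ l i j) (Finset.mem_univ i)
  have hK0 : 0 ≤ K := (Finset.sum_nonneg fun l _ => hHJ l 0 0).trans (hKs 0 0)
  refine ⟨4 * K, by positivity, fun r A hr hA => ?_⟩
  have hA0 : 0 ≤ A := (norm_nonneg _).trans (hA 0 0)
  let m : Fin 3 → ℂ := fun i => ((2 * π) ^ 3)⁻¹ • ∫ w in Box3, r i w
  have hV : (0 : ℝ) < (2 * π) ^ 3 := by positivity
  have hfin : volume Box3 < ⊤ := by
    rw [measure_congr box3_ae_eq]
    exact isCompact_Icc.measure_lt_top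
  have hm : ∀ i, ‖m i‖ ≤ A := by
    intro i
    have h := norm_setIntegral_le_of_norm_le_const hfin fun w _ => hA i w
    rw [volume_box3] at h
    rw [norm_smul, norm_inv, Real.norm_of_nonneg hV.le, inv_mul_le_iff₀ hV, mul_comm]
    exact h
  have hf : ∀ i, PerSmooth fun x => r i x - m i := fun i => (hr i).sub (perSmooth_const _)
  have hf0 : ∀ i, ∫ w in Box3, (r i w - m i) = 0 := by
    intro i
    have hc : Integrable (fun _ : Pt => m i) (volume.restrict Box3) :=
      integrableOn_box3 continuous_const
    rw [integral_sub (integrableOn_box3 (hr i).smooth.continuous) hc, setIntegral_const,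
      volume_box3, smul_inv_smul₀ hV.ne', sub_self]
  have hfA : ∀ i x, ‖r i x - m i‖ ≤ 2 * A := fun i x =>
    (norm_sub_le _ _).trans (by linarith [hA i x, hm i])
  let F : Fin 3 → Pt → ℂ := fun i => neumann η L fun x => r i x - m i
  have hF : ∀ i, PerSmooth (F i) := fun i => (hf i).neumann hiη hT (hf0 i)
  have hFA : ∀ i x, ‖F i x‖ ≤ 4 * A := fun i x =>
    (norm_neumann_le hiη hT (hf i) (hf0 i) (hfA i) x).trans (by linarith)
  have hRs : ∀ l i j, PerSmooth (timeOp (κ l i j) L (F l)) := fun l i j =>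
    (hF l).avgOp (integrable_timeKernel (hiκ l i j) L) measurable_timeShift
  refine ⟨fun i j x => -∑ l, timeOp (κ l i j) L (F l) x, m,
    fun i j => (PerSmooth.sum _ fun l => hRs l i j).neg, fun i j => ?_, fun x => ?_,
    fun i x => ?_, fun i j x => ?_, fun i j x y => ?_⟩
  · simp only [hsymm _ i j]
  · rw [Finset.sum_neg_distrib, Finset.sum_comm, neg_eq_zero]
    refine Finset.sum_eq_zero fun l _ => ?_
    have h := integral_finsetSum Finset.univ fun i _ => integrable_timeOp (hiκ l i i) L (hF l) x
    simp only [timeOp, avgOp]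
    rw [← h]
    simp only [← Finset.sum_smul, htr, zero_smul, integral_zero]
  · have e : ∀ j, pd j (fun x => -∑ l, timeOp (κ l i j) L (F l) x) x
        = -∑ l, pd j (timeOp (κ l i j) L (F l)) x := fun j => by
      rw [pd_neg, pd_sum _ fun l => (hRs l i j).differentiable]
    simp only [e]
    rw [Finset.sum_neg_distrib, Finset.sum_comm, Finset.sum_eq_single i]
    · rw [sum_pd_timeOp hη sη (hκ i i) (sκ i i) (fun y => by simpa using hdiv i i y) hL.le (hF i),
        hI, one_smul, neg_sub]
      exact neumann_sub_scaledOp hiη hT (hf i) (hf0 i) x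
    · intro l _ hl
      rw [sum_pd_timeOp (η := fun _ => 0) contDiff_const HasCompactSupport.zero (hκ l i) (sκ l i)
        (fun y => by rw [hdiv, if_neg hl.symm]; simp [pd]) hL.le (hF l)]
      simp [scaledOp, avgOp]
    · simp
  · rw [norm_neg]
    calc _ ≤ ∑ l, (H l i j + J l i j) * (4 * A) := by
          refine norm_sum_le_of_le _ fun l _ => ?_
          refine (norm_avgOp_le (integrable_timeKernel (hiκ l i j) L) (hFA l) x).trans ?_
          gcongr
          exact le_add_of_nonneg_left (hH0 l i j)
      _ ≤ K * (4 * A) := by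
          rw [← Finset.sum_mul]
          gcongr
          exact hKs i j
      _ = 4 * K * A := by ring
  · rw [neg_sub_neg, ← Finset.sum_sub_distrib]
    calc _ ≤ ∑ l, (H l i j + J l i j) * (4 * A) * ‖x - y‖ ^ α := by
          refine norm_sum_le_of_le _ fun l _ => ?_
          rw [norm_sub_rev]
          refine (hH l i j (F l) (4 * A) (hF l) (hFA l) x y).trans ?_
          gcongr
          exact le_add_of_nonneg_right (hJ0 l i j)
      _ ≤ K * (4 * A) * ‖x - y‖ ^ α := by
          rw [← Finset.sum_mul, ← Finset.sum_mul]
          gcongr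
          exact hKs i j
      _ = 4 * K * A * ‖x - y‖ ^ α := by ring

/-! ### Bounds on partial derivatives and interpolation -/

/-- All partial derivatives of order `j` are bounded by `B`. -/
def OrderBound : ℕ → ℝ → (Pt → ℝ) → Prop
  | 0, B, f => ∀ x, ‖f x‖ ≤ B
  | j + 1, B, f => ∀ i, OrderBound j B (pd i f)

theorem OrderBound.mono {j : ℕ} {B B' : ℝ} (hB : B ≤ B') :
    ∀ {f : Pt → ℝ}, OrderBound j B f → OrderBound j B' f := by
  induction j with
  | zero => exact fun h x => (h x).trans hB
  | succ j ih => exact fun h i => ih (h i)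

theorem OrderBound.of_forall_add {j : ℕ} {B : ℝ} :
    ∀ {f : Pt → ℝ}, (∀ ε > 0, OrderBound j (B + ε) f) → OrderBound j B f := by
  induction j with
  | zero => exact fun h x => le_of_forall_pos_le_add fun ε hε => h ε hε x
  | succ j ih => exact fun h i => ih fun ε hε => h ε hε i

theorem PerSmooth.exists_orderBound (j : ℕ) :
    ∀ {f : Pt → ℝ}, PerSmooth f → ∃ B, 0 ≤ B ∧ OrderBound j B f := by
  induction j with
  | zero => exact fun h => h.bounded
  | succ j ih =>
    intro f hf
    choose B hB0 hB using fun i => ih (hf.pd i)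
    exact ⟨∑ i, B i, Finset.sum_nonneg fun i _ => hB0 i, fun i =>
      (hB i).mono (Finset.single_le_sum (fun i _ => hB0 i) (Finset.mem_univ i))⟩

theorem norm_pd_le_of_bounds {f : Pt → ℝ} (hf : PerSmooth f) {A B h : ℝ} (hh : 0 < h)
    (hA : ∀ x, ‖f x‖ ≤ A) (i : Fin 3) (hB : ∀ x, ‖pd i (pd i f) x‖ ≤ B) (x : Pt) :
    ‖pd i f x‖ ≤ 2 * A / h + h * B := by
  have line : ∀ {g : Pt → ℝ}, PerSmooth g → ∀ s : ℝ,
      HasDerivAt (fun s : ℝ => g (x + s • Pi.single i 1)) (pd i g (x + s • Pi.single i 1)) s := by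
    intro g hg s
    have h1 : HasDerivAt (fun s : ℝ => x + s • (Pi.single i 1 : Pt)) (Pi.single i 1) s := by
      simpa using ((hasDerivAt_id s).smul_const (Pi.single i 1 : Pt)).const_add x
    exact (hg.differentiable _).hasFDerivAt.comp_hasDerivAt s h1
  have hB0 : 0 ≤ B := (norm_nonneg _).trans (hB 0)
  have h1 : ∀ s ∈ Set.Icc 0 h, ‖pd i f (x + s • Pi.single i 1) - pd i f x‖ ≤ h * B := by
    intro s hs
    have := norm_image_sub_le_of_norm_deriv_le_segment' (a := 0) (b := h) (C := B)
      (fun t _ => (line (hf.pd i) t).hasDerivWithinAt) (fun t _ => hB _) s hs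
    simp only [zero_smul, add_zero, sub_zero] at this
    refine this.trans ?_
    rw [mul_comm]
    gcongr
    exact hs.2
  have h2 := norm_image_sub_le_of_norm_deriv_le_segment' (a := 0) (b := h) (C := h * B)
    (fun t _ => ((line hf t).sub ((hasDerivAt_id t).mul_const (pd i f x))).hasDerivWithinAt)
    (fun t ht => by simpa using h1 t ⟨ht.1, ht.2.le⟩) h ⟨hh.le, le_rfl⟩
  simp only [Pi.sub_apply, id, zero_smul, add_zero, zero_mul, sub_zero] at h2
  have h3 : h * ‖pd i f x‖ ≤ 2 * A + h * B * h := by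
    have e : h * pd i f x = (f (x + h • Pi.single i 1) - f x)
        - (f (x + h • Pi.single i 1) - h * pd i f x - f x) := by ring
    calc h * ‖pd i f x‖ = ‖h * pd i f x‖ := by rw [norm_mul, Real.norm_of_nonneg hh.le]
      _ ≤ (A + A) + h * B * h := by
        rw [e]
        exact (norm_sub_le _ _).trans (add_le_add ((norm_sub_le _ _).trans
          (add_le_add (hA _) (hA _))) h2)
      _ = _ := by ring
  have e : 2 * A / h + h * B = (2 * A + h * B * h) / h := by field_simp
  rw [e, le_div_iff₀ hh, mul_comm]
  exact h3

theorem OrderBound.middle {j : ℕ} {A B h : ℝ} (hh : 0 < h) :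
    ∀ {f : Pt → ℝ}, PerSmooth f → OrderBound j A f → OrderBound (j + 2) B f →
      OrderBound (j + 1) (2 * A / h + h * B) f := by
  induction j with
  | zero => exact fun hf hA hB i => norm_pd_le_of_bounds hf hh hA i (hB i i)
  | succ j ih => exact fun hf hA hB i => ih (hf.pd i) (hA i) (hB i)

theorem absorb_half {P : ℝ → Prop} (hmono : ∀ X X', X ≤ X' → P X → P X')
    (hclosed : ∀ X, (∀ ε > 0, P (X + ε)) → P X) {Y X₀ : ℝ} (hX₀ : 0 ≤ X₀) (hY : 0 ≤ Y)
    (h0 : P X₀) (hstep : ∀ X, 0 ≤ X → P X → P (X / 2 + Y)) : P (2 * Y) := by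
  have hn : ∀ n : ℕ, P (2 * Y + X₀ * (1 / 2) ^ n) := by
    intro n
    induction n with
    | zero => exact hmono _ _ (by simp; linarith) h0
    | succ n ih =>
      refine hmono _ _ (le_of_eq ?_) (hstep _ (by positivity) ih)
      ring
  refine hclosed _ fun ε hε => ?_
  obtain ⟨n, hn'⟩ := exists_pow_lt_of_lt_one (show 0 < ε / (X₀ + 1) by positivity)
    (show (1 / 2 : ℝ) < 1 by norm_num)
  rw [lt_div_iff₀ (by positivity)] at hn'
  refine hmono _ _ ?_ (hn n)
  have : (0 : ℝ) ≤ (1 / 2) ^ n := by positivity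
  nlinarith

theorem exists_interpolation (j : ℕ) : ∀ ε > (0 : ℝ), ∃ K, 0 ≤ K ∧ ∀ (f : Pt → ℝ) (A B μ : ℝ),
    PerSmooth f → 0 ≤ A → 0 ≤ B → 0 < μ → OrderBound 0 A f →
    OrderBound (j + 1) (B * μ ^ (j + 1)) f → OrderBound j ((ε * B + K * A) * μ ^ j) f := by
  induction j with
  | zero =>
    intro ε hε
    refine ⟨1, zero_le_one, fun f A B μ _ _ hB _ h0 _ => h0.mono ?_⟩
    have : 0 ≤ ε * B := by positivity
    simp
    linarith
  | succ j ih =>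
    intro ε hε
    obtain ⟨K, hK0, hK⟩ := ih (ε / 8) (by positivity)
    refine ⟨8 / ε * K, by positivity, fun f A B μ hf hA hB hμ h0 h2 => ?_⟩
    have e : ε * B + 8 / ε * K * A = 2 * (ε / 2 * B + 4 / ε * K * A) := by ring
    rw [e]
    obtain ⟨X₀, hX₀, hX⟩ := hf.exists_orderBound (j + 1)
    refine absorb_half (P := fun X => OrderBound (j + 1) (X * μ ^ (j + 1)) f)
      (X₀ := X₀ / μ ^ (j + 1)) (fun X X' h => OrderBound.mono (by gcongr)) (fun X h => ?_)
      (by positivity) (by positivity) ?_ (fun X hX0 hXb => ?_)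
    · refine OrderBound.of_forall_add fun δ hδ => ?_
      refine (h (δ / μ ^ (j + 1)) (by positivity)).mono (le_of_eq ?_)
      field_simp
    · exact hX.mono (le_of_eq (by field_simp))
    · have h1 := hK f A X μ hf hA hX0 hμ h0 hXb
      refine (h1.middle (h := ε / 2 / μ) (by positivity) hf h2).mono (le_of_eq ?_)
      field_simp
      ring

theorem exists_interpolation_all (N : ℕ) : ∃ K, 1 ≤ K ∧ ∀ (f : Pt → ℝ) (A μ : ℝ),
    PerSmooth f → 0 ≤ A → 0 < μ → OrderBound 0 A f → OrderBound N (A * μ ^ N) f →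
    ∀ j ≤ N, OrderBound j (K * A * μ ^ j) f := by
  induction N with
  | zero =>
    refine ⟨1, le_rfl, fun f A μ _ _ _ h0 _ j hj => ?_⟩
    obtain rfl : j = 0 := by omega
    simpa using h0
  | succ N ih =>
    obtain ⟨K₁, hK₁, h₁⟩ := ih
    obtain ⟨K₂, hK₂, h₂⟩ := exists_interpolation N 1 one_pos
    have hone : 1 ≤ K₁ * (1 + K₂) := by nlinarith
    refine ⟨K₁ * (1 + K₂), hone, fun f A μ hf hA hμ h0 hN j hj => ?_⟩
    rcases Nat.lt_or_ge N j with hj' | hj'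
    · obtain rfl : j = N + 1 := by omega
      refine hN.mono ?_
      gcongr
      exact le_mul_of_one_le_left hA hone
    · have h3 := h₂ f A A μ hf hA hA hμ h0 hN
      refine (h₁ f ((1 + K₂) * A) μ hf (by positivity) hμ (h0.mono ?_) (h3.mono ?_) j hj').mono
        (le_of_eq ?_)
      · nlinarith
      · exact le_of_eq (by ring)
      · ring

theorem orderBound_of_iteratedFDeriv {j : ℕ} {B : ℝ} : ∀ {f : Pt → ℝ}, ContDiff ℝ ∞ f →
    (∀ x, ‖iteratedFDeriv ℝ j f x‖ ≤ B) → OrderBound j B f := by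
  induction j with
  | zero => exact fun _ h x => by simpa using h x
  | succ j ih =>
    intro f hf h i
    refine ih (contDiff_pd hf i) fun x => le_trans ?_ (h x)
    have hd : ContDiff ℝ j (fderiv ℝ f) := hf.fderiv_right (m := j) (by exact_mod_cast le_top)
    have e : pd i f = (ContinuousLinearMap.apply ℝ ℝ (Pi.single i 1 : Pt)) ∘ fderiv ℝ f := rfl
    have h1 := (ContinuousLinearMap.apply ℝ ℝ (Pi.single i 1 : Pt)).norm_iteratedFDeriv_comp_left
      hd.contDiffAt (le_refl (j : WithTop ℕ∞)) (x := x)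
    rw [← e, norm_iteratedFDeriv_fderiv] at h1
    refine h1.trans (mul_le_of_le_one_left (norm_nonneg _) ?_)
    refine ContinuousLinearMap.opNorm_le_bound _ zero_le_one fun T => ?_
    have := T.le_opNorm (Pi.single i 1 : Pt)
    rw [Pi.norm_single, norm_one, mul_one] at this
    simpa using this

/-! ### Symbol classes, uniformly over a family of parameters -/

section Symbols

variable {ι : Type*} {μ : ι → ℝ}

/-- A family `f p` of smooth periodic functions whose derivatives of order `j ≤ n` are bounded by
a constant multiple of `M p * μ p ^ j`, uniformly in the parameter `p`. -/
def Symb (μ : ι → ℝ) : ℕ → (ι → ℝ) → (ι → Pt → ℝ) → Prop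
  | 0, M, f => (∀ p, PerSmooth (f p)) ∧ ∃ K, ∀ p x, ‖f p x‖ ≤ K * M p
  | n + 1, M, f => ((∀ p, PerSmooth (f p)) ∧ ∃ K, ∀ p x, ‖f p x‖ ≤ K * M p) ∧
      ∀ i, Symb μ n (fun p => M p * μ p) (fun p => pd i (f p))

namespace Symb

theorem zero_of {n : ℕ} {M : ι → ℝ} {f : ι → Pt → ℝ} (h : Symb μ n M f) :
    (∀ p, PerSmooth (f p)) ∧ ∃ K, ∀ p x, ‖f p x‖ ≤ K * M p := by
  cases n with
  | zero => exact h
  | succ n => exact h.1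

theorem of_succ {n : ℕ} : ∀ {M : ι → ℝ} {f : ι → Pt → ℝ}, Symb μ (n + 1) M f → Symb μ n M f := by
  induction n with
  | zero => exact fun h => h.1
  | succ n ih => exact fun h => ⟨h.1, fun i => ih (h.2 i)⟩

theorem of_le {n m : ℕ} (hnm : n ≤ m) {M : ι → ℝ} {f : ι → Pt → ℝ} (h : Symb μ m M f) :
    Symb μ n M f := by
  induction m, hnm using Nat.le_induction with
  | base => exact h
  | succ m _ ih => exact ih h.of_succ

theorem of_orderBound {n : ℕ} : ∀ {M : ι → ℝ} {f : ι → Pt → ℝ}, (∀ p, PerSmooth (f p)) →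
    (∃ K, ∀ p, ∀ j ≤ n, OrderBound j (K * M p * μ p ^ j) (f p)) → Symb μ n M f := by
  induction n with
  | zero =>
    rintro M f hf ⟨K, hK⟩
    refine ⟨hf, K, fun p x => ?_⟩
    have := hK p 0 le_rfl
    simpa [OrderBound] using this x
  | succ n ih =>
    rintro M f hf ⟨K, hK⟩
    refine ⟨⟨hf, K, fun p x => ?_⟩, fun i => ih (fun p => (hf p).pd i) ⟨K, fun p j hj => ?_⟩⟩
    · have := hK p 0 (Nat.zero_le _)
      simpa [OrderBound] using this x
    · have := hK p (j + 1) (by omega) i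
      rwa [pow_succ', show K * M p * (μ p * μ p ^ j) = K * (M p * μ p) * μ p ^ j by ring] at this

theorem add {n : ℕ} : ∀ {M : ι → ℝ} {f g : ι → Pt → ℝ}, Symb μ n M f → Symb μ n M g →
    Symb μ n M (fun p x => f p x + g p x) := by
  have h0 : ∀ {M : ι → ℝ} {f g : ι → Pt → ℝ}, Symb μ 0 M f → Symb μ 0 M g →
      Symb μ 0 M (fun p x => f p x + g p x) := by
    rintro M f g ⟨hf, K, hK⟩ ⟨hg, L, hL⟩
    refine ⟨fun p => (hf p).add (hg p), K + L, fun p x => ?_⟩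
    rw [add_mul]
    exact norm_add_le_of_le (hK p x) (hL p x)
  induction n with
  | zero => exact h0
  | succ n ih =>
    intro M f g hf hg
    refine ⟨h0 hf.1 hg.1, fun i => ?_⟩
    have e : (fun p => pd i (fun x => f p x + g p x)) =
        fun p x => pd i (f p) x + pd i (g p) x := by
      funext p x
      exact pd_add (hf.1.1 p).differentiable (hg.1.1 p).differentiable i x
    rw [e]
    exact ih (hf.2 i) (hg.2 i)

theorem mul {n : ℕ} : ∀ {M M' : ι → ℝ} {f g : ι → Pt → ℝ}, Symb μ n M f → Symb μ n M' g →
    Symb μ n (fun p => M p * M' p) (fun p x => f p x * g p x) := by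
  have h0 : ∀ {M M' : ι → ℝ} {f g : ι → Pt → ℝ}, Symb μ 0 M f → Symb μ 0 M' g →
      Symb μ 0 (fun p => M p * M' p) (fun p x => f p x * g p x) := by
    rintro M M' f g ⟨hf, K, hK⟩ ⟨hg, L, hL⟩
    refine ⟨fun p => ⟨(hf p).smooth.mul (hg p).smooth, fun l x => by
      simp only [(hf p).per l x, (hg p).per l x]⟩, K * L, fun p x => ?_⟩
    rw [norm_mul, mul_mul_mul_comm]
    exact mul_le_mul (hK p x) (hL p x) (norm_nonneg _) ((norm_nonneg _).trans (hK p x))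
  induction n with
  | zero => exact h0
  | succ n ih =>
    intro M M' f g hf hg
    refine ⟨h0 hf.1 hg.1, fun i => ?_⟩
    have e : (fun p => pd i (fun x => f p x * g p x)) =
        fun p x => f p x * pd i (g p) x + pd i (f p) x * g p x := by
      funext p x
      exact pd_mul (hf.1.1 p).differentiable (hg.1.1 p).differentiable i x
    rw [e]
    refine add ?_ ?_
    · have := ih hf.of_succ (hg.2 i)
      simpa only [mul_assoc] using this
    · have := ih (hf.2 i) hg.of_succ
      simpa only [mul_right_comm] using this

theorem const (n : ℕ) (c : ℝ) : Symb μ n (fun _ => 1) (fun _ _ => c) := by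
  have hz : ∀ n (M : ι → ℝ), Symb μ n M (fun _ _ => 0) := by
    intro n
    induction n with
    | zero => exact fun M => ⟨fun p => perSmooth_const _, 0, fun p x => by simp⟩
    | succ n ih =>
      refine fun M => ⟨⟨fun p => perSmooth_const _, 0, fun p x => by simp⟩, fun i => ?_⟩
      convert ih _ using 3
      simp [pd]
  cases n with
  | zero => exact ⟨fun p => perSmooth_const _, ‖c‖, fun p x => by simp⟩
  | succ n =>
    refine ⟨⟨fun p => perSmooth_const _, ‖c‖, fun p x => by simp⟩, fun i => ?_⟩
    convert hz n _ using 3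
    simp [pd]

theorem const_mul {n : ℕ} (c : ℝ) {M : ι → ℝ} {f : ι → Pt → ℝ} (hf : Symb μ n M f) :
    Symb μ n M (fun p x => c * f p x) := by
  simpa only [one_mul] using (const n c).mul hf

theorem sum {n : ℕ} {M : ι → ℝ} {f : Fin 3 → ι → Pt → ℝ} (hf : ∀ a, Symb μ n M (f a)) :
    Symb μ n M (fun p x => ∑ a, f a p x) := by
  simpa only [Fin.sum_univ_three] using ((hf 0).add (hf 1)).add (hf 2)

theorem inv {n : ℕ} {q : ι → Pt → ℝ} (hq : Symb μ n (fun _ => 1) q) {c : ℝ} (hc : 0 < c)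
    (hqc : ∀ p x, c ≤ q p x) : Symb μ n (fun _ => 1) (fun p x => (q p x)⁻¹) := by
  have h0 : (∀ p, PerSmooth fun x => (q p x)⁻¹) ∧ ∃ K, ∀ p x, ‖(q p x)⁻¹‖ ≤ K * (1 : ℝ) := by
    refine ⟨fun p => ⟨(hq.zero_of.1 p).smooth.inv fun x => (hc.trans_le (hqc p x)).ne', fun l x => by
      simp only [(hq.zero_of.1 p).per l x]⟩, c⁻¹, fun p x => ?_⟩
    rw [norm_inv, mul_one]
    exact inv_anti₀ hc ((hqc p x).trans (le_abs_self _))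
  induction n with
  | zero => exact h0
  | succ n ih =>
    refine ⟨h0, fun i => ?_⟩
    have e : (fun p => pd i (fun x => (q p x)⁻¹)) =
        fun p x => (-1) * (pd i (q p) x * ((q p x)⁻¹ * (q p x)⁻¹)) := by
      funext p x
      have hne := (hc.trans_le (hqc p x)).ne'
      have hd := ((hq.1.1 p).differentiable x).hasFDerivAt
      have hi : HasFDerivAt (fun x => (q p x)⁻¹) _ x :=
        (hasDerivAt_inv hne).comp_hasFDerivAt x hd
      rw [pd, hi.fderiv]
      simp only [_root_.smul_apply, smul_eq_mul, pd]
      field_simp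
    rw [e]
    have h1 := ih hq.of_succ
    have := ((hq.2 i).mul (h1.mul h1)).const_mul (-1)
    simpa only [mul_one] using this

end Symb

end Symbols

/-! ### Amplitudes of the stationary phase expansion -/

section Amplitudes

/-- A symmetric trace-free matrix field `S` with `S w = a`. -/
def stress (w a : Fin 3 → Pt → ℝ) (i j : Fin 3) (x : Pt) : ℝ :=
  (a i x * w j x + a j x * w i x) * (∑ m, w m x * w m x)⁻¹
    - 1 / 2 * ((∑ m, a m x * w m x) * ((w i x * w j x)
        * ((∑ m, w m x * w m x)⁻¹ * (∑ m, w m x * w m x)⁻¹)))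
    - 1 / 2 * ((∑ m, a m x * w m x) * ((∑ m, w m x * w m x)⁻¹ * if i = j then 1 else 0))

theorem stress_symm (w a : Fin 3 → Pt → ℝ) (i j : Fin 3) : stress w a i j = stress w a j i := by
  funext x
  by_cases h : i = j
  · rw [h]
  · simp only [stress, if_neg h, if_neg (Ne.symm h)]
    ring

theorem stress_trace {w : Fin 3 → Pt → ℝ} {x : Pt} (hw : ∑ m, w m x * w m x ≠ 0)
    (a : Fin 3 → Pt → ℝ) : ∑ i, stress w a i i x = 0 := by
  have h := mul_inv_cancel₀ hw
  simp only [stress, Fin.sum_univ_three, if_true] at h ⊢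
  generalize (w 0 x * w 0 x + w 1 x * w 1 x + w 2 x * w 2 x)⁻¹ = r at h ⊢
  linear_combination (-1 / 2 * (a 0 x * w 0 x + a 1 x * w 1 x + a 2 x * w 2 x) * r) * h

theorem stress_mulVec {w : Fin 3 → Pt → ℝ} {x : Pt} (hw : ∑ m, w m x * w m x ≠ 0)
    (a : Fin 3 → Pt → ℝ) (i : Fin 3) : ∑ j, stress w a i j x * w j x = a i x := by
  have h := mul_inv_cancel₀ hw
  have hij : ∑ j, (if i = j then 1 else 0) * w j x = w i x := by simp
  simp only [stress, Fin.sum_univ_three] at h hij ⊢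
  generalize (w 0 x * w 0 x + w 1 x * w 1 x + w 2 x * w 2 x)⁻¹ = r at h ⊢
  linear_combination (a i x - 1 / 2 * w i x * (a 0 x * w 0 x + a 1 x * w 1 x + a 2 x * w 2 x) * r) * h
    - 1 / 2 * (a 0 x * w 0 x + a 1 x * w 1 x + a 2 x * w 2 x) * r * hij

/-- The amplitudes of the stationary phase expansion with normalised phase gradient `w`. -/
def amplitude (w : Fin 3 → Pt → ℝ) (b : Pt → ℝ) : ℕ → Fin 3 → Pt → ℝ
  | 0, _ => b
  | n + 1, i => fun x => ∑ j, pd j (stress w (amplitude w b n) i j) x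

variable {ι : Type*} {μ : ι → ℝ} {w : Fin 3 → ι → Pt → ℝ} {c : ℝ}

theorem Symb.stress {n : ℕ} (hc : 0 < c) (hw : ∀ i, Symb μ n (fun _ => 1) (w i))
    (hwc : ∀ p x, c ≤ ∑ m, w m p x * w m p x) {M : ι → ℝ} {a : Fin 3 → ι → Pt → ℝ}
    (ha : ∀ i, Symb μ n M (a i)) (i j : Fin 3) :
    Symb μ n M (fun p => stress (fun i => w i p) (fun i => a i p) i j) := by
  have hww : ∀ i j, Symb μ n (fun _ => 1) (fun p x => w i p x * w j p x) := fun i j => by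
    simpa only [mul_one] using (hw i).mul (hw j)
  have haw : ∀ i j, Symb μ n M (fun p x => a i p x * w j p x) := fun i j => by
    simpa only [mul_one] using (ha i).mul (hw j)
  have hq : Symb μ n (fun _ => 1) (fun p x => (∑ m, w m p x * w m p x)⁻¹) :=
    (Symb.sum fun m => hww m m).inv hc hwc
  have hs : Symb μ n M (fun p x => ∑ m, a m p x * w m p x) := Symb.sum fun m => haw m m
  have h1 := ((haw i j).add (haw j i)).mul hq
  have h2 := (hs.mul ((hww i j).mul (hq.mul hq))).const_mul (-(1 / 2))
  have h3 := (hs.mul (hq.mul (Symb.const n (if i = j then 1 else 0)))).const_mul (-(1 / 2))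
  simp only [mul_one] at h1 h2 h3
  convert (h1.add h2).add h3 using 3
  simp only [_root_.stress]
  ring

theorem Symb.amplitude {N : ℕ} (hc : 0 < c) (hw : ∀ i, Symb μ N (fun _ => 1) (w i))
    (hwc : ∀ p x, c ≤ ∑ m, w m p x * w m p x) {M : ι → ℝ} {b : ι → Pt → ℝ}
    (hb : Symb μ N M b) (n m : ℕ) (hnm : n + m = N) (i : Fin 3) :
    Symb μ m (fun p => M p * μ p ^ n) (fun p => amplitude (fun i => w i p) (b p) n i) := by
  induction n generalizing m i with
  | zero =>
    rw [zero_add] at hnm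
    subst hnm
    simp only [pow_zero, mul_one]
    exact hb
  | succ n ih =>
    have h1 := fun i => ih (m + 1) (by omega) i
    have h2 : ∀ j, Symb μ (m + 1) (fun p => M p * μ p ^ n) _ := fun j =>
      Symb.stress hc (fun i => (hw i).of_le (by omega)) hwc h1 i j
    have h3 := Symb.sum fun j => (h2 j).2 j
    simp only [mul_assoc, ← pow_succ] at h3
    exact h3

end Amplitudes

/-! ### The phase -/

section Phase

theorem one_le_enorm3_int {k : Fin 3 → ℤ} (hk : k ≠ 0) : 1 ≤ enorm3 fun i => (k i : ℝ) := by
  obtain ⟨i, hi⟩ := Function.ne_iff.1 hk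
  rw [enorm3, Real.one_le_sqrt]
  have h1 : (1 : ℝ) ≤ (k i : ℝ) ^ 2 := by
    have : (1 : ℤ) ≤ k i ^ 2 := by have := sq_pos_of_ne_zero (a := k i) hi; omega
    exact_mod_cast this
  exact h1.trans (Finset.single_le_sum (f := fun i => (k i : ℝ) ^ 2) (fun _ _ => sq_nonneg _)
    (Finset.mem_univ i))

theorem abs_le_enorm3 (w : Pt) (i : Fin 3) : |w i| ≤ enorm3 w := by
  rw [enorm3]
  exact Real.abs_le_sqrt (Finset.single_le_sum (f := fun i => w i ^ 2) (fun _ _ => sq_nonneg _)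
    (Finset.mem_univ i))

/-- The linear functional of the unit vector `k / |k|`. -/
def unitFunctional (k : Fin 3 → ℤ) : Pt →L[ℝ] ℝ :=
  ∑ m, ((k m : ℝ) / enorm3 fun i => (k i : ℝ)) • ContinuousLinearMap.proj m

theorem unitFunctional_apply (k : Fin 3 → ℤ) (y : Pt) :
    unitFunctional k y = ∑ m, ((k m : ℝ) / enorm3 fun i => (k i : ℝ)) * y m := by
  simp [unitFunctional]

theorem norm_unitFunctional_le {k : Fin 3 → ℤ} (hk : k ≠ 0) : ‖unitFunctional k‖ ≤ 3 := by
  have hl := one_le_enorm3_int hk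
  refine ContinuousLinearMap.opNorm_le_bound _ (by norm_num) fun y => ?_
  rw [unitFunctional_apply]
  have : ∀ m, ‖((k m : ℝ) / enorm3 fun i => (k i : ℝ)) * y m‖ ≤ ‖y‖ := by
    intro m
    rw [norm_mul, norm_div, Real.norm_of_nonneg (zero_le_one.trans hl)]
    calc _ ≤ 1 * ‖y‖ := by
          gcongr
          · exact div_le_one_of_le₀ (abs_le_enorm3 (fun i => (k i : ℝ)) m) (zero_le_one.trans hl)
          · exact norm_le_pi_norm y m
      _ = _ := one_mul _
  calc _ ≤ ∑ _m : Fin 3, ‖y‖ := norm_sum_le_of_le _ fun m _ => this m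
    _ = 3 * ‖y‖ := by simp

/-- The phase `k · ξ / |k|`. -/
def phase (ξ : Pt → Pt) (k : Fin 3 → ℤ) (x : Pt) : ℝ := unitFunctional k (ξ x)

variable {ξ : Pt → Pt} {k : Fin 3 → ℤ}

theorem contDiff_phase (hξ : ContDiff ℝ ∞ ξ) : ContDiff ℝ ∞ (phase ξ k) :=
  (unitFunctional k).contDiff.comp hξ

theorem perSmooth_pd_phase (hξ : ContDiff ℝ ∞ ξ) (hp : PhaseMap ξ) (i : Fin 3) :
    PerSmooth (pd i (phase ξ k)) := by
  refine ⟨contDiff_pd (contDiff_phase hξ) i, fun l x => ?_⟩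
  have e : (fun y => phase ξ k (y + fun i => 2 * π * (l i : ℝ))) =
      fun y => phase ξ k y + unitFunctional k fun i => 2 * π * (l i : ℝ) := by
    funext y
    rw [phase, hp l y, map_add, phase]
  rw [pd, pd, ← fderiv_comp_add_right, e, fderiv_add_const]

theorem pd_phase (hξ : ContDiff ℝ ∞ ξ) (i : Fin 3) (x : Pt) :
    pd i (phase ξ k) x = ∑ m, pd i ξ x m * ((k m : ℝ) / enorm3 fun i => (k i : ℝ)) := by
  have h := (unitFunctional k).hasFDerivAt.comp x
    (hξ.differentiable (by simp) x).hasFDerivAt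
  have h2 : pd i (phase ξ k) x = unitFunctional k (pd i ξ x) := by
    rw [pd, show phase ξ k = unitFunctional k ∘ ξ from rfl, h.fderiv]
    rfl
  rw [h2, unitFunctional_apply]
  exact Finset.sum_congr rfl fun m _ => mul_comm _ _

theorem norm_pd_phase_le {C : ℝ} (hk : k ≠ 0) (hξ : ContDiff ℝ ∞ ξ) (hC : NonDeg C ξ) (i : Fin 3)
    (x : Pt) : ‖pd i (phase ξ k) x‖ ≤ 3 * C := by
  have h := (unitFunctional k).hasFDerivAt.comp x
    (hξ.differentiable (by simp) x).hasFDerivAt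
  refine (norm_pd_le _ i x).trans ?_
  rw [show phase ξ k = unitFunctional k ∘ ξ from rfl, h.fderiv]
  exact (ContinuousLinearMap.opNorm_comp_le _ _).trans
    (mul_le_mul (norm_unitFunctional_le hk) (hC.2 x) (norm_nonneg _) (by norm_num))

theorem sum_sq_pd_phase_ge {C : ℝ} (h0 : 0 < C) (hk : k ≠ 0) (hξ : ContDiff ℝ ∞ ξ)
    (hC : NonDeg C ξ) (x : Pt) :
    C⁻¹ ^ 2 ≤ ∑ m, pd m (phase ξ k) x * pd m (phase ξ k) x := by
  have hl := one_le_enorm3_int hk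
  set lam := enorm3 fun i => (k i : ℝ) with hlam
  have h1 : enorm3 (fun m => (k m : ℝ) / lam) = 1 := by
    have hsq : ∑ i, (k i : ℝ) ^ 2 = lam ^ 2 := by
      rw [hlam, enorm3, Real.sq_sqrt (Finset.sum_nonneg fun _ _ => sq_nonneg _)]
    have : (lam : ℝ) ≠ 0 := by positivity
    simp only [enorm3, div_pow, ← Finset.sum_div, hsq]
    rw [div_self (pow_ne_zero 2 this), Real.sqrt_one]
  have h2 := hC.1 x fun m => (k m : ℝ) / lam
  rw [h1, mul_one] at h2
  simp only [hlam, ← pd_phase hξ] at h2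
  rw [enorm3, Real.le_sqrt (by positivity) (Finset.sum_nonneg fun _ _ => sq_nonneg _)] at h2
  simpa only [sq] using h2

theorem osc_eq (hk : k ≠ 0) (x : Pt) : osc ξ k x =
    Complex.exp (Complex.I * (((enorm3 fun i => (k i : ℝ)) * phase ξ k x : ℝ) : ℂ)) := by
  have hl := one_le_enorm3_int hk
  have : (enorm3 fun i => (k i : ℝ)) * phase ξ k x = ∑ m, (k m : ℝ) * ξ x m := by
    rw [phase, unitFunctional_apply, Finset.mul_sum]
    refine Finset.sum_congr rfl fun m _ => ?_
    field_simp
  rw [osc, this]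

theorem norm_osc (x : Pt) : ‖osc ξ k x‖ = 1 := by
  rw [osc, mul_comm]
  exact Complex.norm_exp_ofReal_mul_I _

theorem perSmooth_osc (hξ : ContDiff ℝ ∞ ξ) (hp : PhaseMap ξ) : PerSmooth (osc ξ k) := by
  refine ⟨?_, fun l x => ?_⟩
  · have h1 : ContDiff ℝ ∞ fun x => ∑ m, (k m : ℝ) * ξ x m :=
      ContDiff.sum fun m _ => contDiff_const.mul (contDiff_pi.1 hξ m)
    exact (contDiff_const.mul (Complex.ofRealCLM.contDiff.comp h1)).cexp
  · have : (∑ m, (k m : ℝ) * (ξ x + fun i => 2 * π * (l i : ℝ)) m) =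
        (∑ m, (k m : ℝ) * ξ x m) + ((∑ m, k m * l m : ℤ) : ℝ) * (2 * π) := by
      push_cast
      rw [Finset.sum_mul, ← Finset.sum_add_distrib]
      refine Finset.sum_congr rfl fun m _ => ?_
      simp only [Pi.add_apply]
      ring
    rw [osc, hp l x, this, osc]
    rw [Complex.exp_eq_exp_iff_exists_int]
    refine ⟨∑ m, k m * l m, ?_⟩
    push_cast
    ring

theorem pd_osc (hk : k ≠ 0) (hξ : ContDiff ℝ ∞ ξ) (i : Fin 3) (x : Pt) :
    pd i (osc ξ k) x = Complex.I * ((enorm3 fun i => (k i : ℝ)) : ℂ) *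
      ((pd i (phase ξ k) x : ℝ) : ℂ) * osc ξ k x := by
  have h1 := (((contDiff_phase (k := k) hξ).differentiable (by simp) x).hasFDerivAt.const_mul
    (enorm3 fun i => (k i : ℝ)))
  have h2 := ((Complex.ofRealCLM.hasFDerivAt.comp x h1).const_mul Complex.I).cexp
  have h3 : osc ξ k = fun x => Complex.exp (Complex.I *
      (Complex.ofRealCLM ∘ fun x => (enorm3 fun i => (k i : ℝ)) * phase ξ k x) x) := by
    funext x
    exact osc_eq hk x
  rw [pd, h3, h2.fderiv]
  simp [pd]
  ring

/-- The product of an oscillatory factor and a real amplitude. -/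
theorem pd_const_mul_osc (hk : k ≠ 0) (hξ : ContDiff ℝ ∞ ξ) (hp : PhaseMap ξ) {s : Pt → ℝ}
    (hs : PerSmooth s) (z : ℂ) (i : Fin 3) (x : Pt) :
    pd i (fun y => z * (s y : ℂ) * osc ξ k y) x = z * ((pd i s x : ℝ) : ℂ) * osc ξ k x +
      z * (Complex.I * ((enorm3 fun i => (k i : ℝ)) : ℂ)) *
        ((s x * pd i (phase ξ k) x : ℝ) : ℂ) * osc ξ k x := by
  have h1 := (Complex.ofRealCLM.hasFDerivAt.comp x (hs.differentiable x).hasFDerivAt).const_mul z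
  have h2 := h1.mul ((perSmooth_osc (k := k) hξ hp).differentiable x).hasFDerivAt
  have h3 : pd i (fun y => z * (s y : ℂ) * osc ξ k y) x = z * (s x : ℂ) * pd i (osc ξ k) x +
      osc ξ k x * (z * ((pd i s x : ℝ) : ℂ)) := by
    rw [pd]
    refine (congrArg (fun L => L (Pi.single i 1)) h2.fderiv).trans ?_
    simp [pd]
  rw [h3, pd_osc hk hξ]
  push_cast
  ring

theorem perSmooth_const_mul_osc (hξ : ContDiff ℝ ∞ ξ) (hp : PhaseMap ξ) {s : Pt → ℝ}
    (hs : PerSmooth s) (z : ℂ) : PerSmooth (fun y => z * (s y : ℂ) * osc ξ k y) :=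
  ⟨(contDiff_const.mul (Complex.ofRealCLM.contDiff.comp hs.smooth)).mul
    (perSmooth_osc hξ hp).smooth, fun l x => by
      simp only [hs.per l x, (perSmooth_osc hξ hp).per l x]⟩

theorem orderBound_pd_phase {N : ℕ} {B : ℝ} (hk : k ≠ 0) (hξ : ContDiff ℝ ∞ ξ)
    (hB : ∀ x, ‖iteratedFDeriv ℝ (N + 1) ξ x‖ ≤ B) (i : Fin 3) :
    OrderBound N (3 * B) (pd i (phase ξ k)) := by
  have h : OrderBound (N + 1) (3 * B) (phase ξ k) := by
    refine orderBound_of_iteratedFDeriv (contDiff_phase hξ) fun x => ?_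
    refine ((unitFunctional k).norm_iteratedFDeriv_comp_left (hξ.contDiffAt (x := x))
      (by exact_mod_cast le_top)).trans ?_
    exact mul_le_mul (norm_unitFunctional_le hk) (hB x) (norm_nonneg _) (by norm_num)
  exact h i

end Phase

/-! ### Non-stationary phase -/

section NonStationaryPhase

/-- Oscillatory data whose amplitude `b` and phase gradient vary on the scale `μ⁻¹`, which is
coarser than the wavelength. -/
structure OscData (C : ℝ) (N : ℕ) where
  b : Pt → ℝ
  ξ : Pt → Pt
  k : Fin 3 → ℤ
  B : ℝ
  μ : ℝ
  smooth_b : PerSmooth b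
  smooth_ξ : ContDiff ℝ ∞ ξ
  phaseMap : PhaseMap ξ
  nonDeg : NonDeg C ξ
  hk : k ≠ 0
  hμ : 0 < μ
  hμk : μ ≤ enorm3 fun i => (k i : ℝ)
  hb : ∀ x, |b x| ≤ B
  hbN : ∀ x, ‖iteratedFDeriv ℝ N b x‖ ≤ B * μ ^ N
  hξN : ∀ x, ‖iteratedFDeriv ℝ (N + 1) ξ x‖ ≤ μ ^ N

namespace OscData

variable {C : ℝ} {N : ℕ}

/-- The frequency. -/
def freq (d : OscData C N) : ℝ := enorm3 fun i => (d.k i : ℝ)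

/-- The normalised phase gradient. -/
def grad (d : OscData C N) (i : Fin 3) : Pt → ℝ := pd i (phase d.ξ d.k)

theorem one_le_freq (d : OscData C N) : 1 ≤ d.freq := one_le_enorm3_int d.hk

theorem B_nonneg (d : OscData C N) : 0 ≤ d.B := (abs_nonneg _).trans (d.hb 0)

theorem symb_b : Symb (OscData.μ (C := C) (N := N)) N OscData.B OscData.b := by
  obtain ⟨K, hK1, hK⟩ := exists_interpolation_all N
  refine Symb.of_orderBound OscData.smooth_b ⟨K, fun d j hj => ?_⟩
  exact hK d.b d.B d.μ d.smooth_b d.B_nonneg d.hμ d.hb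
    (orderBound_of_iteratedFDeriv d.smooth_b.smooth d.hbN) j hj

theorem symb_grad (hC : 1 < C) (i : Fin 3) :
    Symb (OscData.μ (C := C) (N := N)) N (fun _ => 1) (fun d => d.grad i) := by
  obtain ⟨K, hK1, hK⟩ := exists_interpolation_all N
  refine Symb.of_orderBound (fun d => perSmooth_pd_phase d.smooth_ξ d.phaseMap i)
    ⟨K * (3 * C), fun d j hj => ?_⟩
  rw [mul_one]
  refine hK _ (3 * C) d.μ (perSmooth_pd_phase d.smooth_ξ d.phaseMap i) (by linarith) d.hμ
    (norm_pd_phase_le d.hk d.smooth_ξ d.nonDeg i) ?_ j hj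
  refine OrderBound.mono ?_ (orderBound_pd_phase d.hk d.smooth_ξ d.hξN i)
  have := pow_pos d.hμ N
  nlinarith

/-- The amplitudes. -/
def amp (d : OscData C N) (n : ℕ) (i : Fin 3) : Pt → ℝ := amplitude d.grad d.b n i

/-- The stresses. -/
def str (d : OscData C N) (n : ℕ) (i j : Fin 3) : Pt → ℝ := stress d.grad (d.amp n) i j

theorem grad_sq_ge (hC : 1 < C) (d : OscData C N) (x : Pt) :
    C⁻¹ ^ 2 ≤ ∑ m, d.grad m x * d.grad m x :=
  sum_sq_pd_phase_ge (by linarith) d.hk d.smooth_ξ d.nonDeg x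

theorem symb_amp (hC : 1 < C) {n m : ℕ} (h : n + m = N) (i : Fin 3) :
    Symb (OscData.μ (C := C) (N := N)) m (fun d => d.B * d.μ ^ n) (fun d => d.amp n i) :=
  Symb.amplitude (w := fun i d => grad d i) (c := C⁻¹ ^ 2) (by positivity) (symb_grad hC)
    (grad_sq_ge hC) symb_b n m h i

theorem symb_str (hC : 1 < C) {n m : ℕ} (h : n + m = N) (i j : Fin 3) :
    Symb (OscData.μ (C := C) (N := N)) m (fun d => d.B * d.μ ^ n) (fun d => d.str n i j) :=
  Symb.stress (w := fun i d => grad d i) (a := fun i d => amp d n i) (c := C⁻¹ ^ 2)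
    (by positivity) (fun i => (symb_grad hC i).of_le (by omega)) (grad_sq_ge hC)
    (symb_amp hC h) i j

/-- The coefficient `(i / |k|) ^ n`. -/
def coef (d : OscData C N) (n : ℕ) : ℂ := (Complex.I / (d.freq : ℂ)) ^ n

theorem norm_coef (d : OscData C N) (n : ℕ) : ‖d.coef n‖ = (d.freq ^ n)⁻¹ := by
  have := zero_le_one.trans d.one_le_freq
  rw [coef, norm_pow, norm_div, Complex.norm_I, Complex.norm_real, Real.norm_of_nonneg this,
    one_div, inv_pow]

theorem coef_succ_mul (d : OscData C N) (n : ℕ) :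
    -d.coef (n + 1) * (Complex.I * (d.freq : ℂ)) = d.coef n := by
  have : (d.freq : ℂ) ≠ 0 := by
    have := zero_lt_one.trans_le d.one_le_freq
    exact_mod_cast this.ne'
  rw [coef, coef, pow_succ]
  field_simp
  rw [Complex.I_sq]
  ring

/-- The oscillatory stress. -/
def oscStr (d : OscData C N) (n : ℕ) (i j : Fin 3) (x : Pt) : ℂ :=
  -d.coef (n + 1) * (d.str n i j x : ℂ) * osc d.ξ d.k x

theorem perSmooth_oscStr (hC : 1 < C) (d : OscData C N) {n : ℕ} (hn : n < N) (i j : Fin 3) :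
    PerSmooth (d.oscStr n i j) :=
  perSmooth_const_mul_osc d.smooth_ξ d.phaseMap
    ((symb_str hC (Nat.add_sub_of_le hn.le) i j).zero_of.1 d) _

theorem pd_oscStr (d : OscData C N) {n : ℕ} {i j : Fin 3} (hs : PerSmooth (d.str n i j))
    (m : Fin 3) (x : Pt) :
    pd m (d.oscStr n i j) x = -d.coef (n + 1) * ((pd m (d.str n i j) x : ℝ) : ℂ) *
      osc d.ξ d.k x + d.coef n * ((d.str n i j x * d.grad m x : ℝ) : ℂ) * osc d.ξ d.k x := by
  rw [← coef_succ_mul d n]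
  exact pd_const_mul_osc d.hk d.smooth_ξ d.phaseMap hs _ m x

theorem sum_pd_oscStr (hC : 1 < C) (d : OscData C N) {n : ℕ} (hn : n < N) (i : Fin 3) (x : Pt) :
    ∑ j, pd j (d.oscStr n i j) x = d.coef n * (d.amp n i x : ℂ) * osc d.ξ d.k x -
      d.coef (n + 1) * (d.amp (n + 1) i x : ℂ) * osc d.ξ d.k x := by
  have h1 : ∀ j, pd j (d.oscStr n i j) x = -d.coef (n + 1) * ((pd j (d.str n i j) x : ℝ) : ℂ) *
      osc d.ξ d.k x + d.coef n * ((d.str n i j x * d.grad j x : ℝ) : ℂ) * osc d.ξ d.k x :=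
    fun j => d.pd_oscStr ((symb_str hC (Nat.add_sub_of_le hn.le) i j).zero_of.1 d) j x
  have hne : ∑ m, d.grad m x * d.grad m x ≠ 0 :=
    ((by positivity : (0 : ℝ) < C⁻¹ ^ 2).trans_le (d.grad_sq_ge hC x)).ne'
  have h2 : ∑ j, d.str n i j x * d.grad j x = d.amp n i x := stress_mulVec hne _ i
  have h3 : ∑ j, pd j (d.str n i j) x = d.amp (n + 1) i x := rfl
  simp only [h1, Finset.sum_add_distrib, ← Finset.sum_mul, ← Finset.mul_sum, ← Complex.ofReal_sum,
    h2, h3]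
  ring

theorem exists_oscStr_bound (hC : 1 < C) {n : ℕ} (hn : n < N) (i j : Fin 3) :
    ∃ K, 0 ≤ K ∧ ∀ (d : OscData C N) x, ‖d.oscStr n i j x‖ ≤ K * (d.B / d.freq) ∧
      ∀ m, ‖pd m (d.oscStr n i j) x‖ ≤ K * d.B := by
  have hs : Symb (OscData.μ (C := C) (N := N)) 1 (fun d => d.B * d.μ ^ n)
      (fun d => d.str n i j) :=
    (symb_str hC (Nat.add_sub_of_le hn.le) i j).of_le (by omega)
  obtain ⟨K, hK⟩ := hs.1.2
  choose L hL using fun m => (hs.2 m).2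
  refine ⟨|K| + ∑ m, |L m| + |K| * (3 * C), by positivity, fun d x => ?_⟩
  have hB := d.B_nonneg
  have hf := d.one_le_freq
  have hf0 := zero_lt_one.trans_le hf
  have hμ := d.hμ
  have hμf : d.μ ≤ d.freq := d.hμk
  have hpow : ∀ m, (d.freq ^ m)⁻¹ * d.μ ^ m ≤ 1 := fun m => by
    rw [inv_mul_le_iff₀ (by positivity), mul_one]
    gcongr
  have h1 : ‖d.str n i j x‖ ≤ |K| * (d.B * d.μ ^ n) :=
    (hK d x).trans (mul_le_mul_of_nonneg_right (le_abs_self K) (by positivity))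
  have h2 : ‖d.oscStr n i j x‖ ≤ |K| * (d.B / d.freq) := by
    rw [oscStr, norm_mul, norm_osc, norm_mul, norm_neg, norm_coef, Complex.norm_real, mul_one]
    calc _ ≤ (d.freq ^ (n + 1))⁻¹ * (|K| * (d.B * d.μ ^ n)) := by gcongr
      _ = |K| * (d.B / d.freq) * ((d.freq ^ n)⁻¹ * d.μ ^ n) := by
        rw [pow_succ]
        field_simp
      _ ≤ |K| * (d.B / d.freq) * 1 := by
        gcongr
        exact hpow n
      _ = _ := mul_one _
  refine ⟨h2.trans ?_, fun m => ?_⟩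
  · have : 0 ≤ ∑ m, |L m| + |K| * (3 * C) := by positivity
    gcongr
    linarith
  have h3 : ‖pd m (d.str n i j) x‖ ≤ |L m| * (d.B * d.μ ^ n * d.μ) :=
    (hL m d x).trans (mul_le_mul_of_nonneg_right (le_abs_self _) (by positivity))
  have h4 : ‖d.grad m x‖ ≤ 3 * C := norm_pd_phase_le d.hk d.smooth_ξ d.nonDeg m x
  have h6 : ‖-d.coef (n + 1) * ((pd m (d.str n i j) x : ℝ) : ℂ) * osc d.ξ d.k x‖ ≤
      |L m| * d.B := by
    rw [norm_mul, norm_osc, norm_mul, norm_neg, norm_coef, Complex.norm_real, mul_one]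
    calc _ ≤ (d.freq ^ (n + 1))⁻¹ * (|L m| * (d.B * d.μ ^ n * d.μ)) := by gcongr
      _ = |L m| * d.B * ((d.freq ^ (n + 1))⁻¹ * d.μ ^ (n + 1)) := by ring
      _ ≤ |L m| * d.B * 1 := by
        gcongr
        exact hpow _
      _ = _ := mul_one _
  have h7 : ‖d.coef n * ((d.str n i j x * d.grad m x : ℝ) : ℂ) * osc d.ξ d.k x‖ ≤
      |K| * (3 * C) * d.B := by
    rw [norm_mul, norm_osc, norm_mul, norm_coef, Complex.norm_real, mul_one, norm_mul]
    calc _ ≤ (d.freq ^ n)⁻¹ * (|K| * (d.B * d.μ ^ n) * (3 * C)) := by gcongr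
      _ = |K| * (3 * C) * d.B * ((d.freq ^ n)⁻¹ * d.μ ^ n) := by ring
      _ ≤ |K| * (3 * C) * d.B * 1 := by
        gcongr
        exact hpow _
      _ = _ := mul_one _
  rw [d.pd_oscStr (hs.1.1 d)]
  refine (norm_add_le_of_le h6 h7).trans ?_
  rw [← add_mul]
  have : |L m| ≤ ∑ m, |L m| :=
    Finset.single_le_sum (f := fun m => |L m|) (fun m _ => abs_nonneg _) (Finset.mem_univ m)
  gcongr
  linarith [abs_nonneg K]

end OscData

end NonStationaryPhase

/-! ### Inverse divergence of oscillatory data -/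

section Assembly

/-- `R` is a smooth periodic symmetric trace-free field whose divergence is `f` up to constants,
with `C^α` norm at most `T`. -/
structure IsDivInverse (α T : ℝ) (f : Pt → ℂ) (R : Fin 3 → Fin 3 → Pt → ℂ) (m : Fin 3 → ℂ) :
    Prop where
  smooth : ∀ i j, PerSmooth (R i j)
  symm : ∀ i j, R i j = R j i
  trace : ∀ x, ∑ i, R i i x = 0
  div : ∀ i x, ∑ j, pd j (R i j) x = f x - m i
  bound : ∀ i j x, ‖R i j x‖ ≤ T
  holder : ∀ i j x y, ‖R i j x - R i j y‖ ≤ T * ‖x - y‖ ^ α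

theorem IsDivInverse.mono {α T T' : ℝ} (hT : T ≤ T') {f : Pt → ℂ} {R : Fin 3 → Fin 3 → Pt → ℂ}
    {m : Fin 3 → ℂ} (h : IsDivInverse α T f R m) : IsDivInverse α T' f R m :=
  ⟨h.smooth, h.symm, h.trace, h.div, fun i j x => (h.bound i j x).trans hT, fun i j x y =>
    (h.holder i j x y).trans (mul_le_mul_of_nonneg_right hT (by positivity))⟩

theorem norm_sub_le_of_pd_le {f : Pt → ℂ} (hf : PerSmooth f) {L : ℝ}
    (h : ∀ x m, ‖pd m f x‖ ≤ L) (x y : Pt) : ‖f x - f y‖ ≤ 3 * L * ‖x - y‖ := by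
  refine Convex.norm_image_sub_le_of_norm_fderiv_le (𝕜 := ℝ) (s := Set.univ)
    (fun z _ => hf.differentiable z) (fun z _ => ?_) convex_univ (Set.mem_univ y) (Set.mem_univ x)
  have hL : 0 ≤ L := (norm_nonneg _).trans (h z 0)
  refine ContinuousLinearMap.opNorm_le_bound _ (by positivity) fun v => ?_
  rw [fderiv_eq_sum_pd]
  calc _ ≤ ∑ _m : Fin 3, ‖v‖ * L := norm_sum_le_of_le _ fun m _ => by
        rw [norm_smul]
        exact mul_le_mul (norm_le_pi_norm v m) (h z m) (norm_nonneg _) (norm_nonneg _)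
    _ = 3 * L * ‖v‖ := by
      simp only [Finset.sum_const, Finset.card_univ, Fintype.card_fin, nsmul_eq_mul]
      push_cast
      ring

theorem holder_of_scale {α : ℝ} (hα : α ∈ Set.Ioo (0 : ℝ) 1) {f : Pt → ℂ} (hf : PerSmooth f)
    {A lam : ℝ} (hlam : 0 < lam) (h0 : ∀ x, ‖f x‖ ≤ A / lam) (h1 : ∀ x m, ‖pd m f x‖ ≤ A)
    (x y : Pt) : ‖f x - f y‖ ≤ 3 * (A / lam ^ (1 - α)) * ‖x - y‖ ^ α := by
  have hA : 0 ≤ A := (norm_nonneg _).trans (h1 0 0)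
  have hp : 0 < lam ^ (1 - α) := rpow_pos_of_pos hlam _
  set t := ‖x - y‖ with ht
  have ht0 : 0 ≤ t := norm_nonneg _
  have key : ∀ s : ℝ, 0 ≤ s → s = s ^ α * s ^ (1 - α) := fun s hs => by
    rw [← rpow_add_of_nonneg hs hα.1.le (by linarith [hα.2]), add_sub_cancel, rpow_one]
  rcases le_or_gt (t * lam) 1 with h | h
  · refine (norm_sub_le_of_pd_le hf h1 x y).trans ?_
    have h2 : t ^ (1 - α) * lam ^ (1 - α) ≤ 1 := by
      rw [← mul_rpow ht0 hlam.le]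
      exact rpow_le_one (by positivity) h (by linarith [hα.2])
    have h3 : t ^ (1 - α) ≤ (lam ^ (1 - α))⁻¹ := by rwa [← one_div, le_div_iff₀ hp]
    calc 3 * A * t = 3 * A * (t ^ α * t ^ (1 - α)) := by rw [← key t ht0]
      _ ≤ 3 * A * (t ^ α * (lam ^ (1 - α))⁻¹) := by gcongr
      _ = _ := by
        rw [div_eq_mul_inv]
        ring
  · have h2 : 1 ≤ t ^ α * lam ^ α := by
      rw [← mul_rpow ht0 hlam.le]
      exact one_le_rpow h.le hα.1.le
    have h3 : 0 < lam ^ α := rpow_pos_of_pos hlam _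
    calc ‖f x - f y‖ ≤ A / lam + A / lam := norm_sub_le_of_le (h0 x) (h0 y)
      _ = 2 * (A / lam) * 1 := by ring
      _ ≤ 3 * (A / lam) * (t ^ α * lam ^ α) := by
        gcongr
        norm_num
      _ = 3 * (A / (lam ^ α * lam ^ (1 - α))) * (t ^ α * lam ^ α) := by rw [← key lam hlam.le]
      _ = _ := by
        field_simp

theorem OscData.exists_isDivInverse {α C : ℝ} (hα : α ∈ Set.Ioo (0 : ℝ) 1) (hC : 1 < C) (N : ℕ) :
    ∃ K, 0 ≤ K ∧ ∀ d : OscData C N, ∃ R m, IsDivInverse α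
      (K * (d.B / d.freq ^ (1 - α) + d.B * d.μ ^ N / d.freq ^ N))
      (fun x => (d.b x : ℂ) * osc d.ξ d.k x) R m := by
  obtain ⟨S, hS0, hS⟩ := exists_div_inverse hα
  choose K hK0 hK using fun (n : Fin N) i j => exists_oscStr_bound hC n.2 i j
  have hA := fun i => symb_amp hC (add_zero N) i
  choose L hL using fun i => (hA i).2
  let L' := ∑ i, |L i|
  have hL' : ∀ i, |L i| ≤ L' := fun i =>
    Finset.single_le_sum (f := fun i => |L i|) (fun _ _ => abs_nonneg _) (Finset.mem_univ i)
  have hL0 : 0 ≤ L' := (abs_nonneg _).trans (hL' 0)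
  let K' := ∑ i, ∑ j, ∑ n, K n i j
  have hK1 : ∀ i j, 0 ≤ ∑ n, K n i j := fun i j => Finset.sum_nonneg fun n _ => hK0 n i j
  have hK' : ∀ i j, ∑ n, K n i j ≤ K' := fun i j =>
    (Finset.single_le_sum (f := fun j => ∑ n, K n i j) (fun j _ => hK1 i j)
      (Finset.mem_univ j)).trans
    (Finset.single_le_sum (f := fun i => ∑ j, ∑ n, K n i j)
      (fun i _ => Finset.sum_nonneg fun j _ => hK1 i j) (Finset.mem_univ i))
  have hK'0 : 0 ≤ K' := (hK1 0 0).trans (hK' 0 0)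
  refine ⟨3 * K' + S * L', by positivity, fun d => ?_⟩
  have hB := d.B_nonneg
  have hf := d.one_le_freq
  have hf0 := zero_lt_one.trans_le hf
  have hμ := d.hμ
  set X := d.B / d.freq ^ (1 - α) with hX
  set Y := d.B * d.μ ^ N / d.freq ^ N with hY
  have hX0 : 0 ≤ X := by positivity
  have hY0 : 0 ≤ Y := by positivity
  obtain ⟨R, m, hRs, hRsymm, hRtr, hRdiv, hRb, hRh⟩ := hS
    (fun i x => d.coef N * (d.amp N i x : ℂ) * osc d.ξ d.k x) (L' * Y)
    (fun i => perSmooth_const_mul_osc d.smooth_ξ d.phaseMap ((hA i).1 d) _) (fun i x => by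
      rw [norm_mul, norm_osc, norm_mul, norm_coef, Complex.norm_real, mul_one]
      calc _ ≤ (d.freq ^ N)⁻¹ * (|L i| * (d.B * d.μ ^ N)) := by
            gcongr
            exact (hL i d x).trans (mul_le_mul_of_nonneg_right (le_abs_self _) (by positivity))
        _ ≤ (d.freq ^ N)⁻¹ * (L' * (d.B * d.μ ^ N)) := by
            gcongr
            exact hL' i
        _ = L' * Y := by
            rw [hY]
            ring)
  have hQs : ∀ i j, ∀ n : Fin N, PerSmooth (d.oscStr n i j) :=
    fun i j n => d.perSmooth_oscStr hC n.2 i j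
  have hle : d.B / d.freq ≤ X := by
    rw [hX]
    gcongr
    calc d.freq ^ (1 - α) ≤ d.freq ^ (1 : ℝ) :=
          rpow_le_rpow_of_exponent_le hf (by linarith [hα.1])
      _ = _ := rpow_one _
  have hQb : ∀ i j x, ‖∑ n : Fin N, d.oscStr n i j x‖ ≤ 3 * K' * X := by
    intro i j x
    calc _ ≤ ∑ n : Fin N, K n i j * X := norm_sum_le_of_le _ fun n _ =>
          ((hK n i j d x).1).trans (mul_le_mul_of_nonneg_left hle (hK0 n i j))
      _ = (∑ n : Fin N, K n i j) * X := (Finset.sum_mul _ _ _).symm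
      _ ≤ 3 * K' * X := by
        gcongr
        linarith [hK' i j]
  have hQh : ∀ i j x y, ‖(∑ n : Fin N, d.oscStr n i j x) - ∑ n : Fin N, d.oscStr n i j y‖ ≤
      3 * K' * X * ‖x - y‖ ^ α := by
    intro i j x y
    rw [← Finset.sum_sub_distrib]
    calc _ ≤ ∑ n : Fin N, K n i j * (3 * X * ‖x - y‖ ^ α) := norm_sum_le_of_le _ fun n _ => by
          have h := holder_of_scale hα (hQs i j n) (A := K n i j * d.B) hf0
            (fun x => ((hK n i j d x).1).trans (le_of_eq (by ring)))
            (fun x m => (hK n i j d x).2 m) x y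
          refine h.trans (le_of_eq ?_)
          rw [hX]
          ring
      _ = (∑ n : Fin N, K n i j) * (3 * X * ‖x - y‖ ^ α) := (Finset.sum_mul _ _ _).symm
      _ ≤ K' * (3 * X * ‖x - y‖ ^ α) := by
        gcongr
        exact hK' i j
      _ = _ := by ring
  have hT : 3 * K' * X + S * (L' * Y) ≤ (3 * K' + S * L') * (X + Y) := by
    have h1 : 0 ≤ K' * Y := by positivity
    have h2 : 0 ≤ S * L' * X := by positivity
    linarith
  refine ⟨fun i j x => (∑ n : Fin N, d.oscStr n i j x) + R i j x, m, IsDivInverse.mono hT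
    ⟨fun i j => (PerSmooth.sum _ (hQs i j)).add (hRs i j), fun i j => ?_, fun x => ?_,
      fun i x => ?_, fun i j x => ?_, fun i j x y => ?_⟩⟩
  · have h1 : ∀ n : ℕ, d.oscStr n i j = d.oscStr n j i := fun n => by
      funext x
      rw [oscStr, oscStr, str, str, stress_symm]
    funext x
    simp only [h1, hRsymm i j]
  · have hne : ∑ m, d.grad m x * d.grad m x ≠ 0 :=
      ((by positivity : (0 : ℝ) < C⁻¹ ^ 2).trans_le (d.grad_sq_ge hC x)).ne'
    have h1 : ∀ n : ℕ, ∑ i, d.oscStr n i i x = 0 := fun n => by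
      simp only [oscStr, str, ← Finset.sum_mul, ← Finset.mul_sum, ← Complex.ofReal_sum,
        stress_trace hne, Complex.ofReal_zero, mul_zero, zero_mul]
    rw [Finset.sum_add_distrib, Finset.sum_comm, hRtr, add_zero]
    exact Finset.sum_eq_zero fun n _ => h1 n
  · have h1 : ∀ j, pd j (fun x => (∑ n : Fin N, d.oscStr n i j x) + R i j x) x =
        (∑ n : Fin N, pd j (d.oscStr n i j) x) + pd j (R i j) x := fun j => by
      rw [pd_add (PerSmooth.sum _ (hQs i j)).differentiable (hRs i j).differentiable,
        pd_sum _ fun n => (hQs i j n).differentiable]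
    simp only [h1]
    rw [Finset.sum_add_distrib, Finset.sum_comm, hRdiv]
    have h2 : ∑ n : Fin N, ∑ j, pd j (d.oscStr n i j) x =
        d.coef 0 * (d.amp 0 i x : ℂ) * osc d.ξ d.k x -
          d.coef N * (d.amp N i x : ℂ) * osc d.ξ d.k x := by
      rw [← Finset.sum_range_sub' (fun n => d.coef n * (d.amp n i x : ℂ) * osc d.ξ d.k x) N,
        ← Fin.sum_univ_eq_sum_range (fun n => d.coef n * (d.amp n i x : ℂ) * osc d.ξ d.k x -
          d.coef (n + 1) * (d.amp (n + 1) i x : ℂ) * osc d.ξ d.k x) N]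
      exact Finset.sum_congr rfl fun n _ => d.sum_pd_oscStr hC n.2 i x
    have h3 : d.coef 0 = 1 := pow_zero _
    have h4 : d.amp 0 i x = d.b x := rfl
    rw [h2, h3, h4]
    ring
  · exact norm_add_le_of_le (hQb i j x) (hRb i j x)
  · rw [add_sub_add_comm, add_mul]
    exact norm_add_le_of_le (hQh i j x y) (hRh i j x y)

/-- The constants in `IsDivInverse` are the mean of `f`. -/
theorem IsDivInverse.mean {α T : ℝ} {f : Pt → ℂ} (hf : PerSmooth f)
    {R : Fin 3 → Fin 3 → Pt → ℂ} {m : Fin 3 → ℂ} (h : IsDivInverse α T f R m) (i : Fin 3) :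
    m i = (((2 * π) ^ 3 : ℝ) : ℂ)⁻¹ * ∫ y in Box3, f y := by
  have h1 : ∫ y in Box3, (f y - m i) = 0 := by
    simp only [← h.div i]
    rw [integral_finsetSum _ fun j _ =>
      integrableOn_box3 ((h.smooth i j).pd j).smooth.continuous]
    exact Finset.sum_eq_zero fun j _ => integral_box3_pd (h.smooth i j) j
  have hc : Integrable (fun _ : Pt => m i) (volume.restrict Box3) :=
    integrableOn_box3 continuous_const
  rw [integral_sub (integrableOn_box3 hf.smooth.continuous) hc, setIntegral_const, volume_box3,
    sub_eq_zero] at h1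
  have hV : (((2 * π) ^ 3 : ℝ) : ℂ) ≠ 0 := by
    have : (0 : ℝ) < (2 * π) ^ 3 := by positivity
    exact_mod_cast this.ne'
  rw [h1, Complex.real_smul, inv_mul_cancel_left₀ hV]

theorem exists_isDivInverse_osc {α C : ℝ} (hα : α ∈ Set.Ioo (0 : ℝ) 1) (hC : 1 < C) {N : ℕ}
    (hN : 1 ≤ N) : ∃ K, 0 < K ∧ ∀ (b : Pt → ℝ) (ξ : Pt → Pt), PerSmooth b → ContDiff ℝ ∞ ξ →
      PhaseMap ξ → NonDeg C ξ → ∀ Bb Bb1 Bξ1 : ℝ, (∀ x, |b x| ≤ Bb) →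
      (∀ x, ∀ j ≤ N, ‖iteratedFDeriv ℝ j b x‖ ≤ Bb1) →
      (∀ x, ∀ j ≤ N, ‖iteratedFDeriv ℝ (j + 1) ξ x‖ ≤ Bξ1) → ∀ k : Fin 3 → ℤ, k ≠ 0 →
      ∃ R m, IsDivInverse α (K * (Bb / enorm3 (fun i => (k i : ℝ)) ^ ((1 : ℝ) - α)
        + (Bb1 + Bb * Bξ1) / enorm3 (fun i => (k i : ℝ)) ^ ((N : ℝ) - α)))
        (fun x => (b x : ℂ) * osc ξ k x) R m := by
  obtain ⟨S, hS0, hS⟩ := exists_div_inverse hα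
  obtain ⟨K, hK0, hK⟩ := OscData.exists_isDivInverse hα hC N
  refine ⟨S + K + 1, by positivity, fun b ξ hb hξ hp hnd Bb Bb1 Bξ1 hBb hBb1 hBξ1 k hk => ?_⟩
  set lam := enorm3 fun i => (k i : ℝ) with hlam
  have hl1 : 1 ≤ lam := one_le_enorm3_int hk
  have hl0 : 0 < lam := by linarith
  have hB0 : 0 ≤ Bb := (abs_nonneg _).trans (hBb 0)
  have hB10 : 0 ≤ Bb1 := (norm_nonneg _).trans (hBb1 0 0 N.zero_le)
  have hBξ0 : 0 ≤ Bξ1 := (norm_nonneg _).trans (hBξ1 0 0 N.zero_le)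
  set D := Bb1 + Bb * Bξ1 with hD
  have hD0 : 0 ≤ D := by positivity
  have hpow : lam ^ ((N : ℝ) - α) ≤ lam ^ N := by
    rw [← rpow_natCast]
    exact rpow_le_rpow_of_exponent_le hl1 (by linarith [hα.1])
  have hDle : D / lam ^ N ≤ D / lam ^ ((N : ℝ) - α) := by
    have := rpow_pos_of_pos hl0 ((N : ℝ) - α)
    gcongr
  have hX0 : 0 ≤ Bb / lam ^ (1 - α) := by positivity
  have hY0 : 0 ≤ D / lam ^ ((N : ℝ) - α) := by positivity
  rcases le_or_gt (Bb * lam ^ N) D with hcase | hcase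
  · have hle : Bb ≤ D / lam ^ ((N : ℝ) - α) :=
      ((le_div_iff₀ (by positivity)).2 hcase).trans hDle
    obtain ⟨R, m, h1, h2, h3, h4, h5, h6⟩ := hS (fun _ x => (b x : ℂ) * osc ξ k x) Bb
      (fun _ => by simpa only [one_mul] using perSmooth_const_mul_osc hξ hp hb 1)
      (fun _ x => by simpa [norm_osc] using hBb x)
    refine ⟨R, m, IsDivInverse.mono ?_ (⟨h1, h2, h3, h4, h5, h6⟩ : IsDivInverse α (S * Bb) _ R m)⟩
    calc S * Bb ≤ (S + K + 1) * Bb := by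
          gcongr
          linarith
      _ ≤ _ := by
          gcongr
          linarith
  · have hBpos : 0 < Bb := by
      by_contra h
      have : Bb = 0 := le_antisymm (not_lt.1 h) hB0
      rw [this, zero_mul] at hcase
      linarith
    have hBξpos : 0 < Bξ1 := by
      by_contra h
      have h0 : Bξ1 = 0 := le_antisymm (not_lt.1 h) hBξ0
      have h1 : ‖fderiv ℝ ξ 0‖ ≤ 0 := by
        have := hBξ1 0 0 N.zero_le
        rwa [zero_add, norm_iteratedFDeriv_one, h0] at this
      have h2 : ∀ i, pd i ξ 0 = 0 := fun i =>
        norm_le_zero_iff.1 ((norm_pd_le ξ i 0).trans h1)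
      have h3 := hnd.1 0 (fun i => (k i : ℝ))
      simp only [h2, Pi.zero_apply, zero_mul, Finset.sum_const_zero] at h3
      have h4 : enorm3 (fun _ => 0) = 0 := by simp [enorm3]
      rw [h4] at h3
      have : 0 < C⁻¹ * lam := by positivity
      linarith
    have hDpos : 0 < D := by positivity
    have hNne : (N : ℕ) ≠ 0 := by omega
    let μ : ℝ := (D / Bb) ^ ((N : ℝ)⁻¹)
    have hμN : μ ^ N = D / Bb := rpow_inv_natCast_pow (by positivity) hNne
    have hBμ : Bb * μ ^ N = D := by
      rw [hμN]
      field_simp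
    have hμ : 0 < μ := by positivity
    have hμlam : μ ≤ lam := by
      refine le_of_pow_le_pow_left₀ hNne hl0.le ?_
      rw [hμN, div_le_iff₀ hBpos]
      linarith
    let d : OscData C N :=
      { b := b, ξ := ξ, k := k, B := Bb, μ := μ, smooth_b := hb, smooth_ξ := hξ, phaseMap := hp,
        nonDeg := hnd, hk := hk, hμ := hμ, hμk := hμlam, hb := hBb
        hbN := fun x => (hBb1 x N le_rfl).trans (by
          rw [hBμ, hD]
          linarith [mul_nonneg hB0 hBξ0])
        hξN := fun x => (hBξ1 x N le_rfl).trans (by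
          rw [hμN, le_div_iff₀ hBpos, hD]
          linarith) }
    obtain ⟨R, m, h⟩ := hK d
    refine ⟨R, m, IsDivInverse.mono ?_ h⟩
    change K * (Bb / lam ^ (1 - α) + Bb * μ ^ N / lam ^ N) ≤ _
    rw [hBμ]
    calc _ ≤ (S + K + 1) * (Bb / lam ^ (1 - α) + D / lam ^ N) := by
          gcongr
          linarith
      _ ≤ _ := by gcongr

end Assembly

/-- **Hölder estimate for the inverse divergence of oscillatory data.**
Let `α ∈ (0,1)`, `C > 1`, `N ≥ 1`. There is `C' = C'(C,α,N)` such that for smooth `b` and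
a smooth nondegenerate phase `ξ` as above, and every `k ∈ ℤ³∖{0}`, there is a smooth
periodic symmetric trace-free matrix field `R` (namely `R = 𝓡(b e^{ik·ξ})`, applied
componentwise) with `∇·R = b e^{ik·ξ} − ⨍_{𝕋³} b e^{ik·ξ}` and
`‖R‖_{C^α} ≤ C'(‖b‖₀/|k|^{1−α} + (‖b‖_{N+α} + ‖b‖₀‖∇ξ‖_{N+α})/|k|^{N−α})`. -/
theorem inverse_divergence_oscillatory_holder
    (α C : ℝ) (hα : α ∈ Set.Ioo (0 : ℝ) 1) (hC : 1 < C) (N : ℕ) (hN : 1 ≤ N) :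
    ∃ C' : ℝ, 0 < C' ∧
      ∀ (b : Pt → ℝ) (ξ : Pt → Pt),
        (∀ n : ℕ, ContDiff ℝ n b) → per3 b →
        (∀ n : ℕ, ContDiff ℝ n ξ) → PhaseMap ξ → NonDeg C ξ →
        ∀ Bb Bb1 Bξ1 : ℝ,
          -- ‖b‖₀ ≤ Bb
          (∀ x, |b x| ≤ Bb) →
          -- ‖b‖_{N+α} ≤ Bb1
          (∀ x, ∀ j ≤ N, ‖iteratedFDeriv ℝ j b x‖ ≤ Bb1) →
          (∀ x y : Pt, ‖iteratedFDeriv ℝ N b x - iteratedFDeriv ℝ N b y‖ ≤ Bb1 * ‖x - y‖ ^ α) →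
          -- ‖∇ξ‖_{N+α} ≤ Bξ1
          (∀ x, ∀ j ≤ N, ‖iteratedFDeriv ℝ (j + 1) ξ x‖ ≤ Bξ1) →
          (∀ x y : Pt,
            ‖iteratedFDeriv ℝ (N + 1) ξ x - iteratedFDeriv ℝ (N + 1) ξ y‖ ≤ Bξ1 * ‖x - y‖ ^ α) →
          ∀ k : Fin 3 → ℤ, k ≠ 0 →
            ∃ R : Pt → Fin 3 → Fin 3 → ℂ,
              (∀ n : ℕ, ContDiff ℝ n R) ∧ per3 R ∧
              (∀ x i j, R x i j = R x j i) ∧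
              (∀ x, (∑ i, R x i i) = 0) ∧
              -- ∇·R = b e^{ik·ξ} − ⨍ b e^{ik·ξ} (componentwise)
              (∀ x i, (∑ j, pd j (fun y => R y i j) x)
                = (b x : ℂ) * osc ξ k x
                  - (((2 * π) ^ 3 : ℝ) : ℂ)⁻¹ * ∫ y in Box3, (b y : ℂ) * osc ξ k y) ∧
              -- C^α bound: C⁰ part and α-Hölder seminorm
              (∀ x, ‖R x‖
                ≤ C' * (Bb / enorm3 (fun i => (k i : ℝ)) ^ ((1 : ℝ) - α)
                    + (Bb1 + Bb * Bξ1) / enorm3 (fun i => (k i : ℝ)) ^ ((N : ℝ) - α))) ∧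
              (∀ x y : Pt, ‖R x - R y‖
                ≤ C' * (Bb / enorm3 (fun i => (k i : ℝ)) ^ ((1 : ℝ) - α)
                    + (Bb1 + Bb * Bξ1) / enorm3 (fun i => (k i : ℝ)) ^ ((N : ℝ) - α))
                  * ‖x - y‖ ^ α) := by
  obtain ⟨K, hK0, hK⟩ := exists_isDivInverse_osc hα hC hN
  refine ⟨K, hK0, fun b ξ hb hbp hξ hp hnd Bb Bb1 Bξ1 hBb hBb1 _ hBξ1 _ k hk => ?_⟩
  have hbs : PerSmooth b := ⟨contDiff_infty.2 hb, hbp⟩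
  have hξs : ContDiff ℝ ∞ ξ := contDiff_infty.2 hξ
  obtain ⟨R, m, h⟩ := hK b ξ hbs hξs hp hnd Bb Bb1 Bξ1 hBb hBb1 hBξ1 k hk
  have hT := (norm_nonneg _).trans (h.bound 0 0 0)
  have hf : PerSmooth fun x => (b x : ℂ) * osc ξ k x := by
    simpa only [one_mul] using perSmooth_const_mul_osc hξs hp hbs 1
  refine ⟨fun x i j => R i j x, fun n => ?_, fun l x => ?_, fun x i j => ?_, h.trace,
    fun x i => ?_, fun x => ?_, fun x y => ?_⟩
  · exact contDiff_pi.2 fun i => contDiff_pi.2 fun j => contDiff_infty.1 (h.smooth i j).smooth n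
  · funext i j
    exact (h.smooth i j).per l x
  · exact congrFun (h.symm i j) x
  · rw [← h.mean hf i]
    exact h.div i x
  · exact (pi_norm_le_iff_of_nonneg hT).2 fun i => (pi_norm_le_iff_of_nonneg hT).2 fun j =>
      h.bound i j x
  · have hT2 := mul_nonneg hT (rpow_nonneg (norm_nonneg (x - y)) α)
    exact (pi_norm_le_iff_of_nonneg hT2).2 fun i => (pi_norm_le_iff_of_nonneg hT2).2 fun j =>
      h.holder i j x y
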